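/- arXiv:2102.06879 — 6 statements merged into one kernel-verified Lean document; each statement's English description precedes it below -/
import Mathlib

section
/- Unbiasedness of the Sconf risk estimator (Theorem 3): Assume the functions x ↦ ℓ(g(x),+1) and x ↦ ℓ(g(x),−1) are integrable with respect to both μ₊ and μ₋. Then the expectation of R̂(g) over the draw of the n i.i.d. pairs (X₁,X₁'),…,(Xₙ,Xₙ') ~ μ ⊗ μ equals the classification risk: E[R̂(g)] = R(g). -/
open MeasureTheory ProbabilityTheory
open scoped ENNReal BigOperators

/-- The expectation of a sum of `n` i.i.d. copies of an integrable function. -/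
lemma integral_pi_sum_eval {Ω : Type*} [MeasurableSpace Ω] (P : Measure Ω)
    [IsProbabilityMeasure P] (n : ℕ) {h : Ω → ℝ} (hh : Integrable h P) :
    Integrable (fun ω : Fin n → Ω => ∑ i, h (ω i)) (Measure.pi fun _ : Fin n => P) ∧
      ∫ ω : Fin n → Ω, ∑ i, h (ω i) ∂(Measure.pi fun _ : Fin n => P) = n * ∫ z, h z ∂P := by
  have hint (i : Fin n) : Integrable (fun ω : Fin n → Ω => h (ω i))
      (Measure.pi fun _ : Fin n => P) :=
    integrable_comp_eval (μ := fun _ : Fin n => P) hh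
  refine ⟨integrable_finsetSum _ fun i _ => hint i, ?_⟩
  rw [integral_finsetSum _ fun i _ => hint i]
  have heval (i : Fin n) : ∫ ω : Fin n → Ω, h (ω i) ∂(Measure.pi fun _ : Fin n => P)
      = ∫ z, h z ∂P :=
    integral_comp_eval (μ := fun _ : Fin n => P) hh.aestronglyMeasurable
  simp [heval]

/-- Integral of a symmetric rank-two kernel, shifted by a constant, against `f x + f x'`. -/
lemma integral_prod_kernel_mul_add {X : Type*} [MeasurableSpace X] (μ : Measure X)
    [IsProbabilityMeasure μ] {a b f : X → ℝ} (c : ℝ) (ha : Integrable a μ) (hb : Integrable b μ)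
    (hf : Integrable f μ) (haf : Integrable (fun x => a x * f x) μ)
    (hbf : Integrable (fun x => b x * f x) μ) :
    Integrable (fun z : X × X => (a z.1 * a z.2 + b z.1 * b z.2 - c) * (f z.1 + f z.2))
        (μ.prod μ) ∧
      ∫ z : X × X, (a z.1 * a z.2 + b z.1 * b z.2 - c) * (f z.1 + f z.2) ∂(μ.prod μ)
        = 2 * ((∫ x, a x ∂μ) * (∫ x, a x * f x ∂μ) + (∫ x, b x ∂μ) * (∫ x, b x * f x ∂μ)
          - c * ∫ x, f x ∂μ) := by
  have hone : Integrable (fun _ : X => (1 : ℝ)) μ := integrable_const 1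
  have key {u v : X → ℝ} (hu : Integrable u μ) (hv : Integrable v μ) :
      Integrable (fun z : X × X => u z.1 * v z.2 + v z.1 * u z.2) (μ.prod μ) ∧
        ∫ z : X × X, u z.1 * v z.2 + v z.1 * u z.2 ∂(μ.prod μ)
          = 2 * ((∫ x, u x ∂μ) * ∫ x, v x ∂μ) := by
    refine ⟨(hu.mul_prod hv).add (hv.mul_prod hu), ?_⟩
    rw [integral_add (hu.mul_prod hv) (hv.mul_prod hu), integral_prod_mul, integral_prod_mul]
    ring
  obtain ⟨i1, e1⟩ := key ha haf
  obtain ⟨i2, e2⟩ := key hb hbf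
  obtain ⟨i3, e3⟩ := key hone hf
  have hsplit : (fun z : X × X => (a z.1 * a z.2 + b z.1 * b z.2 - c) * (f z.1 + f z.2))
      = fun z : X × X => ((a z.1 * (a z.2 * f z.2) + a z.1 * f z.1 * a z.2)
        + (b z.1 * (b z.2 * f z.2) + b z.1 * f z.1 * b z.2))
        - c * (1 * f z.2 + f z.1 * 1) := by
    funext z; ring
  rw [hsplit]
  refine ⟨(i1.add i2).sub (i3.const_mul c), ?_⟩
  refine (integral_sub (i1.add i2) (i3.const_mul c)).trans ?_
  rw [integral_add' i1 i2, integral_const_mul, e1, e2, e3]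
  simp only [integral_const, probReal_univ, smul_eq_mul]
  ring

/-- Change of measure between two densities: weighting by `w * q / p` turns the integral against
the measure with density `p` into `w` times the integral against the measure with density `q`. -/
lemma integral_withDensity_ratio_mul {X : Type*} [MeasurableSpace X] (ν : Measure X)
    {p q : X → ℝ} (w : ℝ) (hp : Measurable p) (hq : Measurable q) (hq0 : ∀ x, 0 ≤ q x)
    (hpos : ∀ᵐ x ∂ν, 0 < p x) (f : X → ℝ) :
    ∫ x, w * q x / p x * f x ∂(ν.withDensity fun x => ENNReal.ofReal (p x))
      = w * ∫ x, f x ∂(ν.withDensity fun x => ENNReal.ofReal (q x)) := by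
  rw [integral_withDensity_eq_integral_toReal_smul hp.ennreal_ofReal (by simp),
    integral_withDensity_eq_integral_toReal_smul hq.ennreal_ofReal (by simp),
    ← integral_const_mul]
  refine integral_congr_ae ?_
  filter_upwards [hpos] with x hx
  simp only [ENNReal.toReal_ofReal hx.le, ENNReal.toReal_ofReal (hq0 x), smul_eq_mul]
  field_simp

theorem sconf_unbiased_risk_estimator
    {X : Type*} [MeasurableSpace X] (ν : Measure X) [SigmaFinite ν]
    (pp pm : X → ℝ) (hppm : Measurable pp) (hpmm : Measurable pm)
    (hpp0 : ∀ x, 0 ≤ pp x) (hpm0 : ∀ x, 0 ≤ pm x)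
    (μp μm : Measure X) [IsProbabilityMeasure μp] [IsProbabilityMeasure μm]
    (hμp : μp = ν.withDensity fun x => ENNReal.ofReal (pp x))
    (hμm : μm = ν.withDensity fun x => ENNReal.ofReal (pm x))
    (πp πm : ℝ) (hπp0 : 0 < πp) (hπp1 : πp < 1) (hπm : πm = 1 - πp)
    (hpos : ∀ᵐ x ∂ν, 0 < πp * pp x + πm * pm x)
    (μ : Measure X) [IsProbabilityMeasure μ]
    (hμ : μ = ENNReal.ofReal πp • μp + ENNReal.ofReal πm • μm)
    (s : X → X → ℝ)
    (hs : ∀ x x', s x x' = (πp ^ 2 * pp x * pp x' + πm ^ 2 * pm x * pm x') /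
        ((πp * pp x + πm * pm x) * (πp * pp x' + πm * pm x')))
    (hne : πp ≠ πm)
    (ℓ : ℝ → ℝ → ℝ)
    (hℓm1 : Measurable fun z => ℓ z 1) (hℓm2 : Measurable fun z => ℓ z (-1))
    (hℓ01 : ∀ z, 0 ≤ ℓ z 1) (hℓ02 : ∀ z, 0 ≤ ℓ z (-1))
    (g : X → ℝ) (hg : Measurable g)
    (hip1 : Integrable (fun x => ℓ (g x) 1) μp) (him1 : Integrable (fun x => ℓ (g x) 1) μm)
    (hip2 : Integrable (fun x => ℓ (g x) (-1)) μp) (him2 : Integrable (fun x => ℓ (g x) (-1)) μm)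
    (n : ℕ) (hn : 0 < n)
    (Rhatp Rhatm : (X → ℝ) → (Fin n → X × X) → ℝ)
    (hRhatp : ∀ g ω, Rhatp g ω = (1 / (2 * (n : ℝ) * (πp - πm))) *
        ∑ i, (s (ω i).1 (ω i).2 - πm) * (ℓ (g (ω i).1) 1 + ℓ (g (ω i).2) 1))
    (hRhatm : ∀ g ω, Rhatm g ω = (1 / (2 * (n : ℝ) * (πp - πm))) *
        ∑ i, (πp - s (ω i).1 (ω i).2) * (ℓ (g (ω i).1) (-1) + ℓ (g (ω i).2) (-1)))
    (R : (X → ℝ) → ℝ)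
    (hR : ∀ g, R g = πp * (∫ x, ℓ (g x) 1 ∂μp) + πm * ∫ x, ℓ (g x) (-1) ∂μm)
    :
    (∫ ω : Fin n → X × X, (Rhatp g ω + Rhatm g ω) ∂(Measure.pi fun _ : Fin n => μ.prod μ))
      = R g := by
  have hπm0 : 0 < πm := by linarith
  have hπpm : πp - πm ≠ 0 := sub_ne_zero.mpr hne
  have hn' : (n : ℝ) ≠ 0 := by positivity
  set p : X → ℝ := fun x => πp * pp x + πm * pm x with hp
  have hpmeas : Measurable p := (hppm.const_mul πp).add (hpmm.const_mul πm)
  have hμν : μ = ν.withDensity fun x => ENNReal.ofReal (p x) := by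
    rw [hμ, hμp, hμm, ← withDensity_smul _ hppm.ennreal_ofReal,
      ← withDensity_smul _ hpmm.ennreal_ofReal,
      ← withDensity_add_left (hppm.ennreal_ofReal.const_smul _)]
    congr 1
    funext x
    simp only [Pi.add_apply, Pi.smul_apply, smul_eq_mul, hp]
    rw [← ENNReal.ofReal_mul hπp0.le, ← ENNReal.ofReal_mul hπm0.le,
      ← ENNReal.ofReal_add (mul_nonneg hπp0.le (hpp0 x)) (mul_nonneg hπm0.le (hpm0 x))]
  set a : X → ℝ := fun x => πp * pp x / p x with ha
  set b : X → ℝ := fun x => πm * pm x / p x with hb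
  have hameas : Measurable a := (hppm.const_mul πp).div hpmeas
  have hbmeas : Measurable b := (hpmm.const_mul πm).div hpmeas
  have hp_nonneg (x : X) : 0 ≤ p x :=
    add_nonneg (mul_nonneg hπp0.le (hpp0 x)) (mul_nonneg hπm0.le (hpm0 x))
  have ha_bound (x : X) : ‖a x‖ ≤ 1 := by
    have h := mul_nonneg hπp0.le (hpp0 x)
    rw [Real.norm_of_nonneg (div_nonneg h (hp_nonneg x))]
    exact div_le_one_of_le₀ (le_add_of_nonneg_right (mul_nonneg hπm0.le (hpm0 x))) (hp_nonneg x)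
  have hb_bound (x : X) : ‖b x‖ ≤ 1 := by
    have h := mul_nonneg hπm0.le (hpm0 x)
    rw [Real.norm_of_nonneg (div_nonneg h (hp_nonneg x))]
    exact div_le_one_of_le₀ (le_add_of_nonneg_left (mul_nonneg hπp0.le (hpp0 x))) (hp_nonneg x)
  have hia : Integrable a μ :=
    .of_bound hameas.aestronglyMeasurable 1 (Filter.Eventually.of_forall ha_bound)
  have hib : Integrable b μ :=
    .of_bound hbmeas.aestronglyMeasurable 1 (Filter.Eventually.of_forall hb_bound)
  have ha_int (f : X → ℝ) : ∫ x, a x * f x ∂μ = πp * ∫ x, f x ∂μp := by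
    rw [hμν, hμp]
    exact integral_withDensity_ratio_mul ν πp hpmeas hppm hpp0 hpos f
  have hb_int (f : X → ℝ) : ∫ x, b x * f x ∂μ = πm * ∫ x, f x ∂μm := by
    rw [hμν, hμm]
    exact integral_withDensity_ratio_mul ν πm hpmeas hpmm hpm0 hpos f
  have ha_one : ∫ x, a x ∂μ = πp := by simpa using ha_int fun _ => 1
  have hb_one : ∫ x, b x ∂μ = πm := by simpa using hb_int fun _ => 1
  have hs_eq (x x' : X) : s x x' = a x * a x' + b x * b x' := by
    rw [hs, ha, hb, div_mul_div_comm, div_mul_div_comm, ← add_div]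
    congr 1
    ring
  have hsim {f : X → ℝ} (c : ℝ) (hfp : Integrable f μp) (hfm : Integrable f μm) :
      Integrable (fun z : X × X => (s z.1 z.2 - c) * (f z.1 + f z.2)) (μ.prod μ) ∧
        ∫ z : X × X, (s z.1 z.2 - c) * (f z.1 + f z.2) ∂(μ.prod μ)
          = 2 * (πp * (πp * ∫ x, f x ∂μp) + πm * (πm * ∫ x, f x ∂μm)
            - c * (πp * (∫ x, f x ∂μp) + πm * ∫ x, f x ∂μm)) := by
    have hfp' := hfp.smul_measure (c := ENNReal.ofReal πp) ENNReal.ofReal_ne_top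
    have hfm' := hfm.smul_measure (c := ENNReal.ofReal πm) ENNReal.ofReal_ne_top
    have hf : Integrable f μ := hμ ▸ hfp'.add_measure hfm'
    have hf_int : ∫ x, f x ∂μ = πp * (∫ x, f x ∂μp) + πm * ∫ x, f x ∂μm := by
      rw [hμ, integral_add_measure hfp' hfm', integral_smul_measure, integral_smul_measure,
        ENNReal.toReal_ofReal hπp0.le, ENNReal.toReal_ofReal hπm0.le, smul_eq_mul, smul_eq_mul]
    have haf : Integrable (fun x => a x * f x) μ :=
      hf.bdd_mul hameas.aestronglyMeasurable (Filter.Eventually.of_forall ha_bound)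
    have hbf : Integrable (fun x => b x * f x) μ :=
      hf.bdd_mul hbmeas.aestronglyMeasurable (Filter.Eventually.of_forall hb_bound)
    have h := integral_prod_kernel_mul_add μ c hia hib hf haf hbf
    rw [ha_int, hb_int, ha_one, hb_one, hf_int] at h
    simpa only [hs_eq] using h
  obtain ⟨hi1, he1⟩ := hsim πm hip1 him1
  obtain ⟨hi2, he2⟩ := hsim πp hip2 him2
  obtain ⟨hI1, hE1⟩ := integral_pi_sum_eval (μ.prod μ) n hi1
  obtain ⟨hI2, hE2⟩ := integral_pi_sum_eval (μ.prod μ) n hi2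
  have hRhatm' (ω : Fin n → X × X) : Rhatm g ω = -(1 / (2 * (n : ℝ) * (πp - πm))) *
      ∑ i, (s (ω i).1 (ω i).2 - πp) * (ℓ (g (ω i).1) (-1) + ℓ (g (ω i).2) (-1)) := by
    rw [hRhatm, neg_mul, ← mul_neg, ← Finset.sum_neg_distrib]
    simp only [← neg_mul, neg_sub]
  simp only [hRhatp, hRhatm']
  rw [integral_add (hI1.const_mul _) (hI2.const_mul _), integral_const_mul, integral_const_mul,
    hE1, hE2, he1, he2, hR]
  field_simp
  ring
end

section
/- Estimation error bound for Sconf learning (Theorem 4): Let ĝ be a minimizer of R̂ over 𝒢 and g* a minimizer of R over 𝒢 (both assumed to exist). For any δ ∈ (0,1), with probability at least 1−δ over the draw of the n i.i.d. pairs, R(ĝ) − R(g*) ≤ 2·L_ℓ·𝔑ₙ(𝒢)/|π₊−π₋| + (2·C_ℓ/|π₊−π₋|)·√(ln(2/δ)/(2n)). -/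
open MeasureTheory ProbabilityTheory
open scoped ENNReal BigOperators

theorem abs_ciSup_le {ι : Type*} [Nonempty ι] {a : ι → ℝ} {M : ℝ} (h : ∀ i, |a i| ≤ M) :
    |⨆ i, a i| ≤ M := by
  have hb : BddAbove (Set.range a) := ⟨M, by rintro _ ⟨i, rfl⟩; exact (abs_le.1 (h i)).2⟩
  obtain ⟨i⟩ := ‹Nonempty ι›
  exact abs_le.2 ⟨(abs_le.1 (h i)).1.trans (le_ciSup hb i), ciSup_le fun j => (abs_le.1 (h j)).2⟩

theorem le_ciSup_of_abs_le {ι : Type*} {a : ι → ℝ} {M : ℝ} (h : ∀ i, |a i| ≤ M) (i : ι) :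
    a i ≤ ⨆ j, a j :=
  le_ciSup (f := a) ⟨M, by rintro _ ⟨j, rfl⟩; exact (abs_le.1 (h j)).2⟩ i

theorem integrable_of_abs_le {α : Type*} [MeasurableSpace α] {P : Measure α} [IsFiniteMeasure P]
    {f : α → ℝ} (hf : Measurable f) {M : ℝ} (h : ∀ x, |f x| ≤ M) : Integrable f P :=
  Integrable.of_bound hf.aestronglyMeasurable M (Filter.Eventually.of_forall h)

theorem abs_integral_le_of_abs_le {α : Type*} [MeasurableSpace α] {P : Measure α}
    [IsProbabilityMeasure P] {f : α → ℝ} {M : ℝ} (h : ∀ x, |f x| ≤ M) : |∫ x, f x ∂P| ≤ M := by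
  simpa using norm_integral_le_of_norm_le_const (μ := P) (f := f) (C := M)
    (Filter.Eventually.of_forall h)

theorem measurable_finCons {α : Type*} [MeasurableSpace α] (n : ℕ) :
    Measurable fun q : α × (Fin n → α) => (Fin.cons q.1 q.2 : Fin (n + 1) → α) := by
  refine measurable_pi_lambda _ fun i => ?_
  refine Fin.cases ?_ (fun j => ?_) i
  · simpa using measurable_fst
  · simpa [Function.comp_def] using
      (measurable_pi_apply (X := fun _ : Fin n => α) j).comp (measurable_snd (α := α))

theorem measurePreserving_finCons {α : Type*} [MeasurableSpace α] (P : Measure α)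
    [IsProbabilityMeasure P] (n : ℕ) :
    MeasurePreserving (fun q : α × (Fin n → α) => (Fin.cons q.1 q.2 : Fin (n + 1) → α))
      (P.prod (Measure.pi fun _ => P)) (Measure.pi fun _ => P) := by
  have h := (measurePreserving_piFinSuccAbove (fun _ : Fin (n + 1) => P) 0).symm
  convert h using 1
  ext q i
  simp [MeasurableEquiv.piFinSuccAbove_symm_apply, Fin.insertNthEquiv]

theorem integral_pi_succ {α : Type*} [MeasurableSpace α] (P : Measure α)
    [IsProbabilityMeasure P] {n : ℕ} {f : (Fin (n + 1) → α) → ℝ} (hf : Measurable f) {M : ℝ}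
    (hM : ∀ z, |f z| ≤ M) :
    ∫ z, f z ∂(Measure.pi fun _ : Fin (n + 1) => P) =
      ∫ x, ∫ z, f (Fin.cons x z) ∂(Measure.pi fun _ : Fin n => P) ∂P := by
  rw [← (measurePreserving_finCons P n).map_eq,
    integral_map (measurable_finCons n).aemeasurable hf.aestronglyMeasurable,
    integral_prod (fun q : α × (Fin n → α) => f (Fin.cons q.1 q.2))
      (integrable_of_abs_le (hf.comp (measurable_finCons n)) fun q => hM _)]

theorem integral_pi_succ_symm {α : Type*} [MeasurableSpace α] (P : Measure α)
    [IsProbabilityMeasure P] {n : ℕ} {f : (Fin (n + 1) → α) → ℝ} (hf : Measurable f) {M : ℝ}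
    (hM : ∀ z, |f z| ≤ M) :
    ∫ z, f z ∂(Measure.pi fun _ : Fin (n + 1) => P) =
      ∫ z, ∫ x, f (Fin.cons x z) ∂P ∂(Measure.pi fun _ : Fin n => P) := by
  rw [← (measurePreserving_finCons P n).map_eq,
    integral_map (measurable_finCons n).aemeasurable hf.aestronglyMeasurable,
    integral_prod_symm (fun q : α × (Fin n → α) => f (Fin.cons q.1 q.2))
      (integrable_of_abs_le (hf.comp (measurable_finCons n)) fun q => hM _)]

/-- Hoeffding's lemma for a function whose oscillation is at most `c`. -/
theorem integral_exp_le_of_oscillation {α : Type*} [MeasurableSpace α] {P : Measure α}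
    [IsProbabilityMeasure P] {h : α → ℝ} (hm : Measurable h) {c : ℝ} (hc : 0 ≤ c)
    (hosc : ∀ x y, h x ≤ h y + c) (t : ℝ) :
    ∫ x, Real.exp (t * h x) ∂P ≤ Real.exp (t * ∫ x, h x ∂P + (c / 2) ^ 2 * t ^ 2 / 2) := by
  obtain ⟨x₀⟩ := nonempty_of_isProbabilityMeasure P
  have : Nonempty α := ⟨x₀⟩
  have hbdd : BddBelow (Set.range h) :=
    ⟨h x₀ - c, by rintro _ ⟨y, rfl⟩; linarith [hosc x₀ y]⟩
  have hIcc : ∀ x, h x ∈ Set.Icc (⨅ y, h y) ((⨅ y, h y) + c) := fun x =>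
    ⟨ciInf_le hbdd x, by
      have : h x - c ≤ ⨅ y, h y := le_ciInf fun y => by linarith [hosc x y]
      linarith⟩
  have hsub := (hasSubgaussianMGF_of_mem_Icc (μ := P) hm.aemeasurable
    (Filter.Eventually.of_forall hIcc)).mgf_le t
  have hcc : ((((‖(⨅ y, h y) + c - ⨅ y, h y‖₊ / 2) ^ 2 : NNReal)) : ℝ) = (c / 2) ^ 2 := by
    simp [abs_of_nonneg hc]
  rw [hcc, mgf] at hsub
  have hsplit : ∀ x, Real.exp (t * h x) =
      Real.exp (t * ∫ x, h x ∂P) * Real.exp (t * (h x - ∫ x, h x ∂P)) := fun x => by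
    rw [← Real.exp_add]; congr 1; ring
  simp_rw [hsplit]
  rw [integral_const_mul, Real.exp_add]
  exact mul_le_mul_of_nonneg_left hsub (Real.exp_pos _).le

theorem abs_exp_mul_le {t u M : ℝ} (h : |u| ≤ M) : |Real.exp (t * u)| ≤ Real.exp (|t| * M) := by
  rw [abs_of_pos (Real.exp_pos _)]
  refine Real.exp_le_exp.2 ((le_abs_self _).trans ?_)
  rw [abs_mul]
  exact mul_le_mul_of_nonneg_left h (abs_nonneg t)

theorem integral_exp_le_of_bounded_differences {α : Type*} [MeasurableSpace α] {P : Measure α}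
    [IsProbabilityMeasure P] {c : ℝ} (hc : 0 ≤ c) {M : ℝ} (t : ℝ) (n : ℕ) :
    ∀ f : (Fin n → α) → ℝ, Measurable f → (∀ z, |f z| ≤ M) →
      (∀ z i x, f (Function.update z i x) ≤ f z + c) →
      ∫ z, Real.exp (t * f z) ∂(Measure.pi fun _ => P) ≤
        Real.exp (t * ∫ z, f z ∂(Measure.pi fun _ => P) + n * (c / 2) ^ 2 * t ^ 2 / 2) := by
  induction n with
  | zero =>
    intro f _ _ _
    have hconst : f = fun _ => f Fin.elim0 := funext fun z => by rw [Subsingleton.elim z Fin.elim0]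
    rw [hconst]
    simp
  | succ n ih =>
    intro f hf hM hdiff
    have hexp : Measurable fun z => Real.exp (t * f z) := (hf.const_mul t).exp
    have hslice : ∀ x, Measurable fun z : Fin n → α => f (Fin.cons x z) := fun x =>
      hf.comp ((measurable_finCons n).comp (measurable_const.prodMk measurable_id))
    rw [integral_pi_succ P hexp fun z => abs_exp_mul_le (hM z), integral_pi_succ P hf hM]
    set h : α → ℝ := fun x => ∫ z, f (Fin.cons x z) ∂(Measure.pi fun _ : Fin n => P) with hdef
    have hhm : Measurable h :=
      ((hf.comp (measurable_finCons n)).stronglyMeasurable.integral_prod_right').measurable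
    have hhM : ∀ x, |h x| ≤ M := fun x => abs_integral_le_of_abs_le fun z => hM _
    have hosc : ∀ x y, h x ≤ h y + c := by
      intro x y
      have hle : h x ≤ ∫ z, (f (Fin.cons y z) + c) ∂(Measure.pi fun _ : Fin n => P) := by
        refine integral_mono (integrable_of_abs_le (hslice x) fun z => hM _)
          ((integrable_of_abs_le (hslice y) fun z => hM _).add (integrable_const c)) fun z => ?_
        simpa using hdiff (Fin.cons y z) 0 x
      rwa [integral_add (integrable_of_abs_le (hslice y) fun z => hM _) (integrable_const c),
        integral_const, probReal_univ, one_smul] at hle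
    calc ∫ x, ∫ z, Real.exp (t * f (Fin.cons x z)) ∂(Measure.pi fun _ : Fin n => P) ∂P
        ≤ ∫ x, Real.exp (n * (c / 2) ^ 2 * t ^ 2 / 2) * Real.exp (t * h x) ∂P := by
          refine integral_mono ?_ ?_ fun x => ?_
          · exact integrable_of_abs_le
              ((hexp.comp (measurable_finCons n)).stronglyMeasurable.integral_prod_right').measurable
              fun x => abs_integral_le_of_abs_le fun z => abs_exp_mul_le (hM _)
          · exact (integrable_of_abs_le (hhm.const_mul t).exp
              fun x => abs_exp_mul_le (hhM x)).const_mul _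
          · refine (ih (fun z => f (Fin.cons x z)) (hslice x) (fun z => hM _)
              fun z i y => ?_).trans_eq ?_
            · simpa [Fin.cons_update] using hdiff (Fin.cons x z) i.succ y
            · rw [← Real.exp_add, add_comm]
      _ ≤ Real.exp (n * (c / 2) ^ 2 * t ^ 2 / 2) *
            Real.exp (t * ∫ x, h x ∂P + (c / 2) ^ 2 * t ^ 2 / 2) := by
          rw [integral_const_mul]
          exact mul_le_mul_of_nonneg_left (integral_exp_le_of_oscillation hhm hc hosc t)
            (Real.exp_pos _).le
      _ = _ := by
          rw [← Real.exp_add]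
          push_cast
          congr 1
          ring

/-- **McDiarmid's inequality**. -/
theorem measure_ge_le_of_bounded_differences {α : Type*} [MeasurableSpace α] {P : Measure α}
    [IsProbabilityMeasure P] {c : ℝ} (hc : 0 ≤ c) {M : ℝ} {n : ℕ} {f : (Fin n → α) → ℝ}
    (hf : Measurable f) (hM : ∀ z, |f z| ≤ M)
    (hdiff : ∀ z i x, f (Function.update z i x) ≤ f z + c) {ε : ℝ} (hε : 0 ≤ ε) :
    (Measure.pi fun _ => P).real {z | ∫ w, f w ∂(Measure.pi fun _ => P) + ε ≤ f z} ≤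
      Real.exp (-ε ^ 2 / (2 * (n * (c / 2) ^ 2))) := by
  set E := ∫ w, f w ∂(Measure.pi fun _ => P)
  have hsub : HasSubgaussianMGF (fun z => f z - E) (n * (Real.toNNReal c / 2) ^ 2)
      (Measure.pi fun _ => P) := by
    refine ⟨fun t => ?_, fun t => ?_⟩
    · refine integrable_of_abs_le (M := Real.exp (|t| * (M + |E|)))
        ((hf.sub_const E).const_mul t).exp fun z => abs_exp_mul_le ?_
      exact (abs_sub _ _).trans (add_le_add_left (hM z) _)
    · have hmain := integral_exp_le_of_bounded_differences (P := P) hc t n f hf hM hdiff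
      have hsplit : ∀ z, Real.exp (t * (f z - E)) =
          Real.exp (-(t * E)) * Real.exp (t * f z) := fun z => by
        rw [← Real.exp_add]; congr 1; ring
      simp_rw [mgf, hsplit]
      rw [integral_const_mul]
      refine (mul_le_mul_of_nonneg_left hmain (Real.exp_pos _).le).trans_eq ?_
      rw [← Real.exp_add]
      simp only [NNReal.coe_mul, NNReal.coe_natCast, NNReal.coe_pow, NNReal.coe_div,
        Real.coe_toNNReal c hc, NNReal.coe_ofNat]
      congr 1
      ring
  have h := hsub.measure_ge_le hε
  simp only [NNReal.coe_mul, NNReal.coe_natCast, NNReal.coe_pow, NNReal.coe_div,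
        Real.coe_toNNReal c hc, NNReal.coe_ofNat] at h
  simpa only [le_sub_iff_add_le, add_comm ε] using h

theorem integral_iSup_add_sum_le {ι α β : Type*} [Countable ι] [Nonempty ι]
    [MeasurableSpace α] [MeasurableSpace β] {P : Measure α} {Q : Measure β}
    [IsProbabilityMeasure P] [IsProbabilityMeasure Q] {D : ι → α → ℝ} {H : ι → β → ℝ}
    (hD : ∀ i, Measurable (D i)) (hH : ∀ i, Measurable (H i)) {M : ℝ}
    (hDM : ∀ i x, |D i x| ≤ M) (hHM : ∀ i y, |H i y| ≤ M)
    (hstep : ∀ (a : ι → ℝ) (B : ℝ), (∀ i, |a i| ≤ B) →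
      ∫ x, ⨆ i, (a i + D i x) ∂P ≤ ∫ y, ⨆ i, (a i + H i y) ∂Q) (n : ℕ) :
    ∀ (a : ι → ℝ) (B : ℝ), (∀ i, |a i| ≤ B) →
      ∫ z, ⨆ i, (a i + ∑ k, D i (z k)) ∂(Measure.pi fun _ : Fin n => P) ≤
        ∫ w, ⨆ i, (a i + ∑ k, H i (w k)) ∂(Measure.pi fun _ : Fin n => Q) := by
  induction n with
  | zero => intro a B _; simp
  | succ n ih =>
    intro a B hB
    have hsumD : ∀ (m : ℕ) (z : Fin m → α) i, |∑ k, D i (z k)| ≤ m * M := fun m z i => by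
      refine (Finset.abs_sum_le_sum_abs _ _).trans ?_
      simpa using Finset.sum_le_sum fun k (_ : k ∈ Finset.univ) => hDM i (z k)
    have hsumH : ∀ (m : ℕ) (w : Fin m → β) i, |∑ k, H i (w k)| ≤ m * M := fun m w i => by
      refine (Finset.abs_sum_le_sum_abs _ _).trans ?_
      simpa using Finset.sum_le_sum fun k (_ : k ∈ Finset.univ) => hHM i (w k)
    have hmD : Measurable fun z : Fin (n + 1) → α => ⨆ i, (a i + ∑ k, D i (z k)) :=
      .iSup fun i => by fun_prop
    have hmH : Measurable fun w : Fin (n + 1) → β => ⨆ i, (a i + ∑ k, H i (w k)) :=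
      .iSup fun i => by fun_prop
    have hbD : ∀ z : Fin (n + 1) → α,
        |⨆ i, (a i + ∑ k, D i (z k))| ≤ B + (n + 1 : ℕ) * M := fun z =>
      abs_ciSup_le fun i => (abs_add_le _ _).trans (add_le_add (hB i) (hsumD _ z i))
    have hbH : ∀ w : Fin (n + 1) → β,
        |⨆ i, (a i + ∑ k, H i (w k))| ≤ B + (n + 1 : ℕ) * M := fun w =>
      abs_ciSup_le fun i => (abs_add_le _ _).trans (add_le_add (hB i) (hsumH _ w i))
    have hmixM : Measurable fun q : α × (Fin n → β) =>
        ⨆ i, (a i + D i q.1 + ∑ k, H i (q.2 k)) :=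
      .iSup fun i => by fun_prop
    have hmixB : ∀ q : α × (Fin n → β),
        |⨆ i, (a i + D i q.1 + ∑ k, H i (q.2 k))| ≤ B + M + n * M := fun q =>
      abs_ciSup_le fun i => (abs_add_le _ _).trans
        (add_le_add ((abs_add_le _ _).trans (add_le_add (hB i) (hDM i _))) (hsumH _ q.2 i))
    rw [integral_pi_succ P hmD hbD, integral_pi_succ_symm Q hmH hbH]
    calc ∫ x, ∫ z, ⨆ i, (a i + ∑ k, D i ((Fin.cons x z : Fin (n + 1) → α) k))
            ∂(Measure.pi fun _ : Fin n => P) ∂P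
        ≤ ∫ x, ∫ w, ⨆ i, (a i + D i x + ∑ k, H i (w k)) ∂(Measure.pi fun _ : Fin n => Q) ∂P := by
          refine integral_mono ?_ ?_ fun x => ?_
          · exact (integrable_of_abs_le (P := P.prod (Measure.pi fun _ : Fin n => P))
              (hmD.comp (measurable_finCons n)) fun q => hbD _).integral_prod_left
          · exact (integrable_of_abs_le (P := P.prod (Measure.pi fun _ : Fin n => Q))
              hmixM hmixB).integral_prod_left
          · have := ih (fun i => a i + D i x) (B + M) fun i =>
              (abs_add_le _ _).trans (add_le_add (hB i) (hDM i x))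
            simpa [Fin.sum_univ_succ, add_assoc] using this
      _ = ∫ w, ∫ x, ⨆ i, (a i + D i x + ∑ k, H i (w k)) ∂P ∂(Measure.pi fun _ : Fin n => Q) :=
          integral_integral_swap (integrable_of_abs_le hmixM hmixB)
      _ ≤ _ := by
          refine integral_mono ?_ ?_ fun w => ?_
          · exact (integrable_of_abs_le (P := P.prod (Measure.pi fun _ : Fin n => Q))
              hmixM hmixB).integral_prod_right
          · exact (integrable_of_abs_le (P := Q.prod (Measure.pi fun _ : Fin n => Q))
              (hmH.comp (measurable_finCons n)) fun q => hbH _).integral_prod_right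
          · have := hstep (fun i => a i + ∑ k, H i (w k)) (B + n * M) fun i =>
              (abs_add_le _ _).trans (add_le_add (hB i) (hsumH _ w i))
            simpa [Fin.sum_univ_succ, add_assoc, add_comm, add_left_comm] using this

theorem iSup_add_iSup_sub_le {ι : Type*} [Nonempty ι] {a p q : ι → ℝ} {B : ℝ}
    (ha : ∀ i, |a i| ≤ B) {M : ℝ} (hq : ∀ i, |q i| ≤ M)
    (hpq : ∀ i j, |p i - p j| ≤ |q i - q j|) :
    (⨆ i, (a i + p i)) + ⨆ i, (a i - p i) ≤ (⨆ i, (a i + q i)) + ⨆ i, (a i - q i) := by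
  have hplus := le_ciSup_of_abs_le (a := fun i => a i + q i) (M := B + M)
    fun i => (abs_add_le _ _).trans (add_le_add (ha i) (hq i))
  have hminus := le_ciSup_of_abs_le (a := fun i => a i - q i) (M := B + M)
    fun i => (abs_sub _ _).trans (add_le_add (ha i) (hq i))
  rw [← le_sub_iff_add_le]
  refine ciSup_le fun i => ?_
  rw [le_sub_comm]
  refine ciSup_le fun j => ?_
  have h := (le_abs_self _).trans (hpq i j)
  rcases abs_cases (q i - q j) with ⟨habs, _⟩ | ⟨habs, _⟩
  · linarith [hplus i, hminus j]
  · linarith [hplus j, hminus i]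

/-- Truncation of a real number to `[-1, 1]`. -/
def clampUnit (t : ℝ) : ℝ := max (-1) (min 1 t)

theorem measurable_clampUnit : Measurable clampUnit :=
  measurable_const.max (measurable_const.min measurable_id)

theorem abs_clampUnit_le (t : ℝ) : |clampUnit t| ≤ 1 :=
  abs_le.2 ⟨le_max_left _ _, max_le (by norm_num) (min_le_left _ _)⟩

theorem clampUnit_one : clampUnit 1 = 1 := by norm_num [clampUnit]

theorem clampUnit_neg_one : clampUnit (-1) = -1 := by norm_num [clampUnit]

theorem abs_mul_clampUnit_mul_le {K t v C : ℝ} (hK : 0 ≤ K) (hv : |v| ≤ C) :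
    |K * clampUnit t * v| ≤ K * C := by
  rw [abs_mul, abs_mul, abs_of_nonneg hK]
  have h := mul_le_mul (abs_clampUnit_le t) hv (abs_nonneg _) zero_le_one
  rw [mul_assoc]
  exact mul_le_mul_of_nonneg_left (by linarith) hK

theorem integral_rademacher {ρ : Measure ℝ}
    (hρ : ρ = (2⁻¹ : ℝ≥0∞) • Measure.dirac (1 : ℝ) + (2⁻¹ : ℝ≥0∞) • Measure.dirac (-1 : ℝ))
    (f : ℝ → ℝ) : ∫ t, f t ∂ρ = (f 1 + f (-1)) / 2 := by
  have hintegrable : ∀ t : ℝ, Integrable f ((2⁻¹ : ℝ≥0∞) • Measure.dirac t) := fun t =>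
    (integrable_dirac (by simp)).smul_measure (by simp)
  rw [hρ, integral_add_measure (hintegrable _) (hintegrable _), integral_smul_measure, integral_smul_measure,
    integral_dirac, integral_dirac]
  simp
  ring

theorem ae_clampUnit_eq {ρ : Measure ℝ}
    (hρ : ρ = (2⁻¹ : ℝ≥0∞) • Measure.dirac (1 : ℝ) + (2⁻¹ : ℝ≥0∞) • Measure.dirac (-1 : ℝ)) :
    ∀ᵐ t ∂ρ, clampUnit t = t := by
  rw [hρ, ae_add_measure_iff]
  constructor <;> refine Measure.ae_smul_measure ?_ _ <;> rw [ae_dirac_eq]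
  · exact clampUnit_one
  · exact clampUnit_neg_one

/-- One-coordinate symmetrization and contraction for a loss on pairs that is a sum of two
Lipschitz functions of the values of a classifier. -/
theorem integral_iSup_centered_le {ι X : Type*} [Countable ι] [Nonempty ι] [MeasurableSpace X]
    {μ : Measure X} [IsProbabilityMeasure μ] {ρ : Measure ℝ} [IsProbabilityMeasure ρ]
    (hρ : ρ = (2⁻¹ : ℝ≥0∞) • Measure.dirac (1 : ℝ) + (2⁻¹ : ℝ≥0∞) • Measure.dirac (-1 : ℝ))
    {G : ι → X → ℝ} (hG : ∀ i, Measurable (G i)) {C : ℝ} (hC : ∀ i x, |G i x| ≤ C)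
    {u : X × X → ℝ → ℝ} {φ : ι → X × X → ℝ} (hφ : ∀ i, Measurable (φ i))
    (hφu : ∀ i z, φ i z = u z (G i z.1) + u z (G i z.2))
    {M : ℝ} (hu : ∀ z t, |t| ≤ C → |u z t| ≤ M) {L : ℝ} (hL : 0 ≤ L)
    (hLip : ∀ z t t', |t| ≤ C → |t'| ≤ C → |u z t - u z t'| ≤ L * |t - t'|)
    (a : ι → ℝ) (B : ℝ) (ha : ∀ i, |a i| ≤ B) :
    ∫ z, ⨆ i, (a i + (∫ z', φ i z' ∂(μ.prod μ) - φ i z)) ∂(μ.prod μ) ≤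
      ∫ y, ⨆ i, (a i + 4 * L * clampUnit y.2 * G i y.1) ∂(μ.prod ρ) := by
  have hφM : ∀ i z, |φ i z| ≤ M + M := fun i z => by
    rw [hφu]
    exact (abs_add_le _ _).trans (add_le_add (hu _ _ (hC _ _)) (hu _ _ (hC _ _)))
  have h2φ : ∀ i z, |2 * φ i z| ≤ 2 * (M + M) := fun i z => by
    rw [abs_mul, abs_two]; linarith [hφM i z]
  set Tp : X × X → ℝ := fun z => ⨆ i, (a i + 2 * φ i z) with hTp
  set Tm : X × X → ℝ := fun z => ⨆ i, (a i - 2 * φ i z) with hTm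
  set V : X → ℝ := fun x => (⨆ i, (a i + 4 * L * G i x)) + ⨆ i, (a i - 4 * L * G i x) with hV
  have hTpb : ∀ i z, |a i + 2 * φ i z| ≤ B + 2 * (M + M) := fun i z =>
    (abs_add_le _ _).trans (add_le_add (ha i) (h2φ i z))
  have hTmb : ∀ i z, |a i - 2 * φ i z| ≤ B + 2 * (M + M) := fun i z =>
    (abs_sub _ _).trans (add_le_add (ha i) (h2φ i z))
  have hTpi : Integrable Tp (μ.prod μ) :=
    integrable_of_abs_le (.iSup fun i => by fun_prop) fun z => abs_ciSup_le fun i => hTpb i z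
  have hTmi : Integrable Tm (μ.prod μ) :=
    integrable_of_abs_le (.iSup fun i => by fun_prop) fun z => abs_ciSup_le fun i => hTmb i z
  have hq : ∀ i x, |4 * L * G i x| ≤ 4 * L * C := fun i x => by
    rw [abs_mul, abs_of_nonneg (by positivity : 0 ≤ 4 * L)]
    exact mul_le_mul_of_nonneg_left (hC i x) (by positivity)
  have hVp : ∀ i x, |a i + 4 * L * G i x| ≤ B + 4 * L * C := fun i x =>
    (abs_add_le _ _).trans (add_le_add (ha i) (hq i x))
  have hVm : ∀ i x, |a i - 4 * L * G i x| ≤ B + 4 * L * C := fun i x =>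
    (abs_sub _ _).trans (add_le_add (ha i) (hq i x))
  have hVi : Integrable V μ := by
    refine integrable_of_abs_le (M := (B + 4 * L * C) + (B + 4 * L * C)) (.add
      (.iSup fun i => by fun_prop) (.iSup fun i => by fun_prop)) fun x => ?_
    exact (abs_add_le _ _).trans
      (add_le_add (abs_ciSup_le fun i => hVp i x) (abs_ciSup_le fun i => hVm i x))
  have hmean : ∀ i, a i + 2 * ∫ z, φ i z ∂(μ.prod μ) ≤ ∫ z, Tp z ∂(μ.prod μ) := fun i => by
    have hφi := integrable_of_abs_le (P := μ.prod μ) (hφ i) (hφM i)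
    have : ∫ z, (a i + 2 * φ i z) ∂(μ.prod μ) ≤ ∫ z, Tp z ∂(μ.prod μ) :=
      integral_mono ((integrable_const _).add (hφi.const_mul 2)) hTpi fun z =>
        le_ciSup_of_abs_le (a := fun i => a i + 2 * φ i z) (fun i => hTpb i z) i
    rwa [integral_add (integrable_const _) (hφi.const_mul 2), integral_const_mul, integral_const,
      probReal_univ, one_smul] at this
  have hmeanb : ∀ i, |∫ z', φ i z' ∂(μ.prod μ)| ≤ M + M := fun i =>
    abs_integral_le_of_abs_le (hφM i)
  have hpair : ∀ z, Tp z + Tm z ≤ 1 / 2 * V z.1 + 1 / 2 * V z.2 := fun z => by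
    have hcontr : ∀ x, (⨆ i, (a i + 4 * u z (G i x))) + (⨆ i, (a i - 4 * u z (G i x))) ≤ V x :=
      fun x => iSup_add_iSup_sub_le ha (hq · x) fun i j => by
        rw [← mul_sub, ← mul_sub, abs_mul, abs_mul, abs_mul, abs_of_nonneg hL]
        have := hLip z _ _ (hC i x) (hC j x)
        norm_num
        linarith
    have h4u : ∀ i x, |4 * u z (G i x)| ≤ 4 * M := fun i x => by
      rw [abs_mul]; norm_num; exact hu _ _ (hC i x)
    have hp : ∀ i x, a i + 4 * u z (G i x) ≤ ⨆ i, (a i + 4 * u z (G i x)) := fun i x =>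
      le_ciSup_of_abs_le (a := fun i => a i + 4 * u z (G i x)) (M := B + 4 * M)
        (fun i => (abs_add_le _ _).trans (add_le_add (ha i) (h4u i x))) i
    have hm : ∀ i x, a i - 4 * u z (G i x) ≤ ⨆ i, (a i - 4 * u z (G i x)) := fun i x =>
      le_ciSup_of_abs_le (a := fun i => a i - 4 * u z (G i x)) (M := B + 4 * M)
        (fun i => (abs_sub _ _).trans (add_le_add (ha i) (h4u i x))) i
    have h1 : Tp z ≤ 1 / 2 * (⨆ i, (a i + 4 * u z (G i z.1))) +
        1 / 2 * ⨆ i, (a i + 4 * u z (G i z.2)) := ciSup_le fun i => by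
      rw [hφu]; linarith [hp i z.1, hp i z.2]
    have h2 : Tm z ≤ 1 / 2 * (⨆ i, (a i - 4 * u z (G i z.1))) +
        1 / 2 * ⨆ i, (a i - 4 * u z (G i z.2)) := ciSup_le fun i => by
      rw [hφu]; linarith [hm i z.1, hm i z.2]
    linarith [hcontr z.1, hcontr z.2]
  have hV1 : Integrable (fun z : X × X => V z.1) (μ.prod μ) := hVi.comp_fst μ
  have hV2 : Integrable (fun z : X × X => V z.2) (μ.prod μ) := hVi.comp_snd μ
  calc ∫ z, ⨆ i, (a i + (∫ z', φ i z' ∂(μ.prod μ) - φ i z)) ∂(μ.prod μ)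
      ≤ ∫ z, (1 / 2 * ∫ z', Tp z' ∂(μ.prod μ) + 1 / 2 * Tm z) ∂(μ.prod μ) := by
        refine integral_mono (integrable_of_abs_le (M := B + ((M + M) + (M + M)))
          (.iSup fun i => by fun_prop) fun z => abs_ciSup_le fun i => (abs_add_le _ _).trans
            (add_le_add (ha i) ((abs_sub _ _).trans (add_le_add (hmeanb i) (hφM i z)))))
          ((integrable_const _).add (hTmi.const_mul _)) fun z => ciSup_le fun i => ?_
        have := le_ciSup_of_abs_le (a := fun i => a i - 2 * φ i z) (fun i => hTmb i z) i
        linarith [hmean i]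
    _ = 1 / 2 * ∫ z, (Tp z + Tm z) ∂(μ.prod μ) := by
        rw [integral_add (integrable_const _) (hTmi.const_mul _), integral_const, probReal_univ,
          one_smul, integral_const_mul, integral_add hTpi hTmi]
        ring
    _ ≤ 1 / 2 * ∫ z, (1 / 2 * V z.1 + 1 / 2 * V z.2) ∂(μ.prod μ) := by
        refine mul_le_mul_of_nonneg_left (integral_mono (hTpi.add hTmi)
          ((hV1.const_mul _).add (hV2.const_mul _)) hpair) (by norm_num)
    _ = ∫ x, V x / 2 ∂μ := by
        rw [integral_add (hV1.const_mul _) (hV2.const_mul _), integral_const_mul,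
          integral_const_mul, integral_fun_fst, integral_fun_snd, integral_div]
        simp
        ring
    _ = ∫ y, ⨆ i, (a i + 4 * L * clampUnit y.2 * G i y.1) ∂(μ.prod ρ) := by
        have hcl := measurable_clampUnit
        rw [integral_prod _ (integrable_of_abs_le (M := B + 4 * L * C)
          (.iSup fun i => by fun_prop) fun y => abs_ciSup_le fun i => (abs_add_le _ _).trans
            (add_le_add (ha i) (abs_mul_clampUnit_mul_le (by positivity) (hC i y.1))))]
        refine integral_congr_ae (Filter.Eventually.of_forall fun x => ?_)
        simp only [integral_rademacher hρ, clampUnit_one, clampUnit_neg_one, hV, mul_one, mul_neg,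
          neg_mul, sub_eq_add_neg]

/-- A real-valued supremum over the elements of a set is a fixed measurable function of the
supremum over the corresponding subtype; outside the set the inner supremum has value `0`. -/
theorem exists_biSup_eq_comp_iSup_subtype {γ : Type*} (S : Set γ) [Nonempty S] :
    ∃ T : ℝ → ℝ, Measurable T ∧ (∀ t, t ≤ T t) ∧ (∀ t, |T t| ≤ |t|) ∧
      ∀ f : γ → ℝ, ⨆ g ∈ S, f g = T (⨆ g : S, f g) := by
  by_cases h : ∀ g, g ∈ S
  · refine ⟨id, measurable_id, fun _ => le_rfl, fun _ => le_rfl, fun f => ?_⟩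
    exact cbiSup_eq_of_forall (f := fun g : S => f g) h
  · refine ⟨fun t => max t 0, measurable_id.max measurable_const, fun t => le_max_left _ _,
      fun t => ?_, fun f => ?_⟩
    · rw [abs_of_nonneg (le_max_right _ _)]
      exact max_le (le_abs_self t) (abs_nonneg t)
    · rw [cbiSup_eq_of_not_forall (f := fun g : S => f g) h, Real.sSup_empty]

theorem abs_mean_clampUnit_mul_le {n : ℕ} (hn : 0 < n) {C : ℝ} (σ v : Fin n → ℝ)
    (hv : ∀ k, |v k| ≤ C) : |1 / (n : ℝ) * ∑ k, clampUnit (σ k) * v k| ≤ C := by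
  have hn' : (0 : ℝ) < n := Nat.cast_pos.2 hn
  have hsum : |∑ k, clampUnit (σ k) * v k| ≤ n * C := by
    refine (Finset.abs_sum_le_sum_abs _ _).trans ?_
    have h : ∀ k ∈ Finset.univ, |clampUnit (σ k) * v k| ≤ C := fun k _ => by
      simpa using abs_mul_clampUnit_mul_le (t := σ k) zero_le_one (hv k)
    simpa using Finset.sum_le_sum h
  rw [abs_mul, abs_of_pos (by positivity), one_div, inv_mul_le_iff₀ hn']
  exact hsum

theorem integral_iSup_sum_clampUnit_le {X : Type*} [MeasurableSpace X] {μ : Measure X}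
    [IsProbabilityMeasure μ] {ρ : Measure ℝ} [IsProbabilityMeasure ρ]
    (hρ : ρ = (2⁻¹ : ℝ≥0∞) • Measure.dirac (1 : ℝ) + (2⁻¹ : ℝ≥0∞) • Measure.dirac (-1 : ℝ))
    {S : Set (X → ℝ)} (hne : S.Nonempty) (hcount : S.Countable) (hS : ∀ g ∈ S, Measurable g)
    {C : ℝ} (hC : ∀ g ∈ S, ∀ x, |g x| ≤ C) {n : ℕ} (hn : 0 < n) {K : ℝ} (hK : 0 ≤ K) :
    ∫ w, ⨆ g : S, (∑ k, K * clampUnit (w k).2 * g.1 (w k).1)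
        ∂(Measure.pi fun _ : Fin n => μ.prod ρ) ≤
      K * n * ∫ x : Fin n → X, ∫ σ : Fin n → ℝ, (⨆ g ∈ S, (1 / (n : ℝ)) * ∑ i, σ i * g (x i))
        ∂(Measure.pi fun _ : Fin n => ρ) ∂(Measure.pi fun _ : Fin n => μ) := by
  have : Nonempty S := hne.to_subtype
  have : Countable S := hcount.to_subtype
  have hn' : (0 : ℝ) < n := Nat.cast_pos.2 hn
  have hcl := measurable_clampUnit
  have hSm : ∀ g : S, Measurable g.1 := fun g => hS g.1 g.2
  obtain ⟨T, hTm, hTle, hTabs, hT⟩ := exists_biSup_eq_comp_iSup_subtype S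
  set F : (Fin n → X) × (Fin n → ℝ) → ℝ := fun q =>
    ⨆ g : S, 1 / (n : ℝ) * ∑ k, clampUnit (q.2 k) * g.1 (q.1 k) with hF
  have hFm : Measurable F := .iSup fun g => by
    have := hSm g
    fun_prop
  have hFb : ∀ q, |F q| ≤ C := fun q => abs_ciSup_le fun g =>
    abs_mean_clampUnit_mul_le hn _ _ fun k => hC g.1 g.2 _
  have hFi : Integrable F ((Measure.pi fun _ : Fin n => μ).prod (Measure.pi fun _ : Fin n => ρ)) :=
    integrable_of_abs_le hFm hFb
  have hTFi : Integrable (fun q => T (F q))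
      ((Measure.pi fun _ : Fin n => μ).prod (Measure.pi fun _ : Fin n => ρ)) :=
    integrable_of_abs_le (hTm.comp hFm) fun q => (hTabs _).trans (hFb q)
  have hae : ∀ᵐ σ ∂(Measure.pi fun _ : Fin n => ρ), ∀ k, clampUnit (σ k) = σ k := by
    rw [ae_all_iff]
    intro k
    exact (measurePreserving_eval (fun _ : Fin n => ρ) k).quasiMeasurePreserving.ae
      (ae_clampUnit_eq hρ)
  have hrad : ∫ x : Fin n → X, ∫ σ : Fin n → ℝ, (⨆ g ∈ S, (1 / (n : ℝ)) * ∑ i, σ i * g (x i))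
        ∂(Measure.pi fun _ : Fin n => ρ) ∂(Measure.pi fun _ : Fin n => μ) =
      ∫ q, T (F q) ∂((Measure.pi fun _ : Fin n => μ).prod (Measure.pi fun _ : Fin n => ρ)) := by
    rw [integral_prod _ hTFi]
    refine integral_congr_ae (Filter.Eventually.of_forall fun x => integral_congr_ae ?_)
    filter_upwards [hae] with σ hσ
    rw [← hT fun g => 1 / (n : ℝ) * ∑ k, clampUnit (σ k) * g (x k)]
    simp only [hσ]
  have hmp := measurePreserving_arrowProdEquivProdArrow X ℝ (Fin n) (fun _ => μ) (fun _ => ρ)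
  calc ∫ w, ⨆ g : S, (∑ k, K * clampUnit (w k).2 * g.1 (w k).1)
        ∂(Measure.pi fun _ : Fin n => μ.prod ρ)
      = ∫ w, K * n * F (MeasurableEquiv.arrowProdEquivProdArrow X ℝ (Fin n) w)
        ∂(Measure.pi fun _ : Fin n => μ.prod ρ) := by
        refine integral_congr_ae (Filter.Eventually.of_forall fun w => ?_)
        change _ = K * n * ⨆ g : S, 1 / (n : ℝ) * ∑ k, clampUnit (w k).2 * g.1 (w k).1
        rw [Real.mul_iSup_of_nonneg (by positivity)]
        refine iSup_congr fun g => ?_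
        simp only [mul_assoc, ← Finset.mul_sum]
        field_simp
    _ = K * n * ∫ q, F q ∂((Measure.pi fun _ : Fin n => μ).prod (Measure.pi fun _ => ρ)) := by
        rw [integral_const_mul, hmp.integral_comp']
    _ ≤ _ := by
        rw [hrad]
        exact mul_le_mul_of_nonneg_left (integral_mono hFi hTFi fun q => hTle _) (by positivity)

theorem sum_update_le_add {α : Type*} {D : α → ℝ} {c : ℝ} (hD : ∀ x y, D x ≤ D y + c) {n : ℕ}
    (z : Fin n → α) (i : Fin n) (x : α) :
    ∑ k, D (Function.update z i x k) ≤ ∑ k, D (z k) + c := by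
  rw [← Finset.add_sum_erase _ (fun k => D (Function.update z i x k)) (Finset.mem_univ i),
    ← Finset.add_sum_erase _ (fun k => D (z k)) (Finset.mem_univ i)]
  have hrest : ∑ k ∈ Finset.univ.erase i, D (Function.update z i x k) =
      ∑ k ∈ Finset.univ.erase i, D (z k) := Finset.sum_congr rfl fun k hk => by
    rw [Function.update_of_ne (Finset.ne_of_mem_erase hk)]
  simp only [Function.update_self]
  linarith [hD x (z i)]

/-- Generalization bound for empirical minimization of a loss on i.i.d. pairs that is a sum of
two Lipschitz functions of the values of a classifier. -/
theorem le_measure_excess_risk {X : Type*} [MeasurableSpace X] {μ : Measure X}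
    [IsProbabilityMeasure μ] {ρ : Measure ℝ} [IsProbabilityMeasure ρ]
    (hρ : ρ = (2⁻¹ : ℝ≥0∞) • Measure.dirac (1 : ℝ) + (2⁻¹ : ℝ≥0∞) • Measure.dirac (-1 : ℝ))
    {S : Set (X → ℝ)} (hcount : S.Countable) (hS : ∀ g ∈ S, Measurable g)
    {C : ℝ} (hC : ∀ g ∈ S, ∀ x, |g x| ≤ C) {n : ℕ} (hn : 0 < n)
    {u : X × X → ℝ → ℝ} {φ : (X → ℝ) → X × X → ℝ} (hφ : ∀ g ∈ S, Measurable (φ g))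
    (hφu : ∀ g z, φ g z = u z (g z.1) + u z (g z.2))
    {M : ℝ} (hu : ∀ z t, |t| ≤ C → |u z t| ≤ M) {L : ℝ} (hL : 0 ≤ L)
    (hLip : ∀ z t t', |t| ≤ C → |t'| ≤ C → |u z t - u z t'| ≤ L * |t - t'|)
    {c : ℝ} (hc : 0 < c) (hosc : ∀ g ∈ S, ∀ z z', φ g z ≤ φ g z' + c)
    {ghat : (Fin n → X × X) → X → ℝ} {gstar : X → ℝ} (hstar : gstar ∈ S)
    (hghat : ∀ ω, ghat ω ∈ S ∧ ∑ k, φ (ghat ω) (ω k) ≤ ∑ k, φ gstar (ω k))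
    {δ : ℝ} (hδ : δ ∈ Set.Ioo (0 : ℝ) 1) :
    ENNReal.ofReal (1 - δ) ≤ (Measure.pi fun _ : Fin n => μ.prod μ)
      {ω | ∫ z, φ (ghat ω) z ∂(μ.prod μ) - ∫ z, φ gstar z ∂(μ.prod μ) ≤
        4 * L * (∫ x : Fin n → X, ∫ σ : Fin n → ℝ, (⨆ g ∈ S, (1 / (n : ℝ)) * ∑ i, σ i * g (x i))
          ∂(Measure.pi fun _ : Fin n => ρ) ∂(Measure.pi fun _ : Fin n => μ)) +
        2 * c * Real.sqrt (Real.log (2 / δ) / (2 * n))} := by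
  have : Nonempty S := ⟨⟨gstar, hstar⟩⟩
  have : Countable S := hcount.to_subtype
  have hn' : (0 : ℝ) < n := Nat.cast_pos.2 hn
  set Rad := ∫ x : Fin n → X, ∫ σ : Fin n → ℝ, (⨆ g ∈ S, (1 / (n : ℝ)) * ∑ i, σ i * g (x i))
    ∂(Measure.pi fun _ : Fin n => ρ) ∂(Measure.pi fun _ : Fin n => μ)
  set PP := Measure.pi fun _ : Fin n => μ.prod μ with hPP
  set m : (X → ℝ) → ℝ := fun g => ∫ z, φ g z ∂(μ.prod μ) with hm
  set τ := Real.sqrt (Real.log (2 / δ) / (2 * n)) with hτ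
  have hφM : ∀ g ∈ S, ∀ z, |φ g z| ≤ M + M := fun g hg z => by
    rw [hφu]
    exact (abs_add_le _ _).trans (add_le_add (hu _ _ (hC g hg _)) (hu _ _ (hC g hg _)))
  have hmM : ∀ g ∈ S, |m g| ≤ M + M := fun g hg => abs_integral_le_of_abs_le (hφM g hg)
  have hDM : ∀ g ∈ S, ∀ z, |m g - φ g z| ≤ (M + M) + (M + M) := fun g hg z =>
    (abs_sub _ _).trans (add_le_add (hmM g hg) (hφM g hg z))
  have hφS : ∀ g : S, Measurable (φ g) := fun g => hφ g.1 g.2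
  have hsumM : ∀ g ∈ S, ∀ z : Fin n → X × X,
      |∑ k, (m g - φ g (z k))| ≤ n * ((M + M) + (M + M)) := fun g hg z => by
    refine (Finset.abs_sum_le_sum_abs _ _).trans ?_
    exact (Finset.sum_le_sum fun k _ => hDM g hg (z k)).trans_eq (by simp; ring)
  set f : (Fin n → X × X) → ℝ := fun z => ⨆ g : S, ∑ k, (m g - φ g (z k)) with hf
  have hfle : ∀ z (g : S), ∑ k, (m g - φ g (z k)) ≤ f z := fun z =>
    le_ciSup_of_abs_le (a := fun g : S => ∑ k, (m g - φ g (z k))) fun g => hsumM g.1 g.2 z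
  have hfm : Measurable f := .iSup fun g => by
    have := hφS g
    fun_prop
  have hfdiff : ∀ z i x, f (Function.update z i x) ≤ f z + c := fun z i x => ciSup_le fun g =>
    (sum_update_le_add (c := c) (D := fun y => m g - φ g y)
      (fun y y' => by linarith [hosc g.1 g.2 y' y]) z i x).trans (by linarith [hfle z g])
  have hEf : ∫ z, f z ∂PP ≤ 4 * L * n * Rad := by
    obtain ⟨x₀⟩ := nonempty_of_isProbabilityMeasure μ
    have hC0 : 0 ≤ C := (abs_nonneg _).trans (hC gstar hstar x₀)
    have hM0 : 0 ≤ M + M := (abs_nonneg _).trans (hmM gstar hstar)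
    have h := integral_iSup_add_sum_le (ι := S) (P := μ.prod μ) (Q := μ.prod ρ)
      (D := fun g z => m g - φ g z) (H := fun g y => 4 * L * clampUnit y.2 * g.1 y.1)
      (M := ((M + M) + (M + M)) + 4 * L * C) (fun g => by have := hφS g; fun_prop)
      (fun g => by have := hS g.1 g.2; have := measurable_clampUnit; fun_prop)
      (fun g z => (hDM g.1 g.2 z).trans (by linarith [mul_nonneg hL hC0]))
      (fun g y => (abs_mul_clampUnit_mul_le (by positivity) (hC g.1 g.2 _)).trans (by linarith))
      (integral_iSup_centered_le hρ (fun g : S => hS g.1 g.2) (fun g : S => hC g.1 g.2) hφS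
        (fun g : S => hφu g) hu hL hLip) n (fun _ => 0) 0 (by simp)
    simp only [zero_add] at h
    exact h.trans (integral_iSup_sum_clampUnit_le hρ ⟨gstar, hstar⟩ hcount hS hC hn (by positivity))
  set f' : (Fin n → X × X) → ℝ := fun z => ∑ k, (φ gstar (z k) - m gstar) with hf'
  have hf'neg : ∀ z, f' z = -∑ k, (m gstar - φ gstar (z k)) := fun z => by
    simp [hf']
  have hφstar := hφ gstar hstar
  have hf'm : Measurable f' := by fun_prop
  have hf'M : ∀ z, |f' z| ≤ n * ((M + M) + (M + M)) := fun z => by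
    rw [hf'neg, abs_neg]; exact hsumM gstar hstar z
  have hEf' : ∫ z, f' z ∂PP = 0 := by
    have hintegrable : ∀ k : Fin n, Integrable (fun z : Fin n → X × X => φ gstar (z k) - m gstar) PP :=
      fun k => integrable_of_abs_le (by fun_prop) fun z => by
        rw [abs_sub_comm]; exact hDM gstar hstar (z k)
    rw [integral_finsetSum _ fun k _ => hintegrable k]
    refine Finset.sum_eq_zero fun k _ => ?_
    rw [hPP, integral_comp_eval (μ := fun _ : Fin n => μ.prod μ) (i := k)
      (f := fun y => φ gstar y - m gstar) (hφstar.sub_const _).aestronglyMeasurable,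
      integral_sub (integrable_of_abs_le hφstar (hφM gstar hstar)) (integrable_const _)]
    simp [hm]
  have hlog : 0 ≤ Real.log (2 / δ) :=
    Real.log_nonneg (by rw [le_div_iff₀ hδ.1]; linarith [hδ.2])
  have hε : 0 ≤ n * c * τ := by positivity
  have htail : Real.exp (-(n * c * τ) ^ 2 / (2 * (n * (c / 2) ^ 2))) = δ / 2 := by
    have : -(n * c * τ) ^ 2 / (2 * (n * (c / 2) ^ 2)) = -Real.log (2 / δ) := by
      rw [mul_pow, hτ, Real.sq_sqrt (by positivity)]
      field_simp
    rw [this, ← Real.log_inv, inv_div, Real.exp_log (by linarith [hδ.1])]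
  have h1 := measure_ge_le_of_bounded_differences (P := μ.prod μ) hc.le hfm
    (fun z => abs_ciSup_le fun g : S => hsumM g.1 g.2 z) hfdiff hε
  have h2 := measure_ge_le_of_bounded_differences (P := μ.prod μ) hc.le hf'm hf'M
    (fun z i x => sum_update_le_add (c := c) (D := fun y => φ gstar y - m gstar)
      (fun y y' => by linarith [hosc gstar hstar y y']) z i x) hε
  rw [htail] at h1 h2
  set bad := {z | ∫ w, f w ∂PP + n * c * τ ≤ f z} ∪ {z | ∫ w, f' w ∂PP + n * c * τ ≤ f' z}
  have hbadm : MeasurableSet bad :=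
    (measurableSet_le measurable_const hfm).union (measurableSet_le measurable_const hf'm)
  have hbad : PP.real bad ≤ δ := (measureReal_union_le _ _).trans (by linarith)
  have hgood : ENNReal.ofReal (1 - δ) ≤ PP badᶜ := by
    rw [← ofReal_measureReal, probReal_compl_eq_one_sub hbadm]
    exact ENNReal.ofReal_le_ofReal (by linarith)
  refine hgood.trans (measure_mono fun ω hω => ?_)
  simp only [bad, Set.mem_compl_iff, Set.mem_union, Set.mem_ofPred_eq, not_or, not_le, hEf'] at hω
  have hhat := hfle ω ⟨ghat ω, (hghat ω).1⟩
  have hmin := (hghat ω).2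
  have hω2 := hω.2
  simp only [hf', Finset.sum_sub_distrib, Finset.sum_const, Finset.card_univ, Fintype.card_fin,
    nsmul_eq_mul] at hhat hω2
  have htotal : n * (m (ghat ω) - m gstar) ≤ n * (4 * L * Rad + 2 * c * τ) := by
    linarith [hω.1]
  exact le_of_mul_le_mul_left htotal hn'

/-- Unbiased recovery of a weighted integral from the pairwise similarity of the weights. -/
theorem integral_similarity_sub_mul {X : Type*} [MeasurableSpace X] {μ : Measure X}
    [IsProbabilityMeasure μ] {a b F : X → ℝ} {πa πb : ℝ} (ha : Integrable a μ)
    (hb : Integrable b μ) (hF : Integrable F μ) (haF : Integrable (fun x => a x * F x) μ)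
    (hbF : Integrable (fun x => b x * F x) μ) (hπa : ∫ x, a x ∂μ = πa) (hπb : ∫ x, b x ∂μ = πb)
    (hab : ∀ᵐ x ∂μ, a x + b x = 1) :
    ∫ z, (a z.1 * a z.2 + b z.1 * b z.2 - πb) * (F z.1 + F z.2) ∂(μ.prod μ) =
      2 * (πa - πb) * ∫ x, a x * F x ∂μ := by
  have hsum : ∫ x, F x ∂μ = ∫ x, a x * F x ∂μ + ∫ x, b x * F x ∂μ := by
    rw [← integral_add haF hbF]
    refine integral_congr_ae ?_
    filter_upwards [hab] with x hx
    rw [← add_mul, hx, one_mul]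
  have h1 : Integrable (fun _ : X => (1 : ℝ)) μ := integrable_const 1
  have hexpand : ∀ z : X × X, (a z.1 * a z.2 + b z.1 * b z.2 - πb) * (F z.1 + F z.2) =
      ((a z.1 * F z.1) * a z.2 + (b z.1 * F z.1) * b z.2 - πb * (F z.1 * 1)) +
        (a z.1 * (a z.2 * F z.2) + b z.1 * (b z.2 * F z.2) - πb * (1 * F z.2)) :=
    fun z => by ring
  have hcomb : ∀ {f g h : X × X → ℝ}, Integrable f (μ.prod μ) → Integrable g (μ.prod μ) →
      Integrable h (μ.prod μ) → Integrable (fun z => f z + g z - πb * h z) (μ.prod μ) ∧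
      ∫ z, (f z + g z - πb * h z) ∂(μ.prod μ) =
        ∫ z, f z ∂(μ.prod μ) + ∫ z, g z ∂(μ.prod μ) - πb * ∫ z, h z ∂(μ.prod μ) :=
    fun hf hg hh => by
      refine ⟨(hf.add hg).sub (hh.const_mul πb), ?_⟩
      rw [← integral_add hf hg, ← integral_const_mul]
      exact integral_sub (hf.add hg) (hh.const_mul πb)
  obtain ⟨hi1, he1⟩ := hcomb (haF.mul_prod ha) (hbF.mul_prod hb) (hF.mul_prod h1)
  obtain ⟨hi2, he2⟩ := hcomb (ha.mul_prod haF) (hb.mul_prod hbF) (h1.mul_prod hF)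
  simp only [hexpand]
  rw [integral_add hi1 hi2, he1, he2,
    integral_prod_mul (fun x => a x * F x) a, integral_prod_mul (fun x => b x * F x) b,
    integral_prod_mul F fun _ => 1, integral_prod_mul a fun x => a x * F x,
    integral_prod_mul b fun x => b x * F x, integral_prod_mul (fun _ => 1) F, hπa, hπb, hsum]
  simp
  ring

theorem integral_div_mul_withDensity {X : Type*} [MeasurableSpace X] {ν : Measure X}
    {p q : X → ℝ} (hp : Measurable p) (hq : Measurable q) (hp0 : ∀ᵐ x ∂ν, 0 < p x)
    (hq0 : ∀ x, 0 ≤ q x) (F : X → ℝ) :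
    ∫ x, q x / p x * F x ∂(ν.withDensity fun x => ENNReal.ofReal (p x)) =
      ∫ x, F x ∂(ν.withDensity fun x => ENNReal.ofReal (q x)) := by
  rw [integral_withDensity_eq_integral_toReal_smul hp.ennreal_ofReal (by simp),
    integral_withDensity_eq_integral_toReal_smul hq.ennreal_ofReal (by simp)]
  refine integral_congr_ae ?_
  filter_upwards [hp0] with x hx
  rw [ENNReal.toReal_ofReal hx.le, ENNReal.toReal_ofReal (hq0 x), smul_eq_mul, smul_eq_mul]
  field_simp

theorem smul_withDensity_ofReal {X : Type*} [MeasurableSpace X] {ν : Measure X} {p : X → ℝ}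
    (hp : Measurable p) {c : ℝ} (hc : 0 ≤ c) :
    ENNReal.ofReal c • ν.withDensity (fun x => ENNReal.ofReal (p x)) =
      ν.withDensity fun x => ENNReal.ofReal (c * p x) := by
  rw [← withDensity_smul _ hp.ennreal_ofReal]
  congr 1 with x
  simp [ENNReal.ofReal_mul hc]

/-- The similarity confidence lies in the unit interval. -/
theorem similarity_mem_Icc {A B A' B' : ℝ} (hA : 0 ≤ A) (hB : 0 ≤ B) (hA' : 0 ≤ A')
    (hB' : 0 ≤ B') : (A * A' + B * B') / ((A + B) * (A' + B')) ∈ Set.Icc (0 : ℝ) 1 := by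
  refine ⟨by positivity, div_le_one_of_le₀ ?_ (by positivity)⟩
  nlinarith [mul_nonneg hA hB', mul_nonneg hB hA']

/-- The unbiasedness of the similarity-confidence risk estimator. -/
theorem integral_similarity_loss_eq_risk {X : Type*} [MeasurableSpace X] {ν : Measure X}
    {pp pm : X → ℝ} (hpp : Measurable pp) (hpm : Measurable pm) (hpp0 : ∀ x, 0 ≤ pp x)
    (hpm0 : ∀ x, 0 ≤ pm x) {μp μm : Measure X} [IsProbabilityMeasure μp] [IsProbabilityMeasure μm]
    (hμp : μp = ν.withDensity fun x => ENNReal.ofReal (pp x))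
    (hμm : μm = ν.withDensity fun x => ENNReal.ofReal (pm x))
    {πp πm : ℝ} (hπp : 0 ≤ πp) (hπm : 0 ≤ πm)
    (hpos : ∀ᵐ x ∂ν, 0 < πp * pp x + πm * pm x) {μ : Measure X} [IsProbabilityMeasure μ]
    (hμ : μ = ENNReal.ofReal πp • μp + ENNReal.ofReal πm • μm) {s : X → X → ℝ}
    (hs : ∀ x x', s x x' = (πp ^ 2 * pp x * pp x' + πm ^ 2 * pm x * pm x') /
        ((πp * pp x + πm * pm x) * (πp * pp x' + πm * pm x')))
    (hne : πp ≠ πm) {F G : X → ℝ} (hF : Measurable F) (hG : Measurable G) {M : ℝ}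
    (hFM : ∀ x, |F x| ≤ M) (hGM : ∀ x, |G x| ≤ M) :
    ∫ z, 1 / (2 * (πp - πm)) * ((s z.1 z.2 - πm) * (F z.1 + F z.2) +
        (πp - s z.1 z.2) * (G z.1 + G z.2)) ∂(μ.prod μ) =
      πp * ∫ x, F x ∂μp + πm * ∫ x, G x ∂μm := by
  set p : X → ℝ := fun x => πp * pp x + πm * pm x with hp
  have hpmeas : Measurable p := by fun_prop
  have hμp' : ENNReal.ofReal πp • μp = ν.withDensity fun x => ENNReal.ofReal (πp * pp x) := by
    rw [hμp, smul_withDensity_ofReal hpp hπp]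
  have hμm' : ENNReal.ofReal πm • μm = ν.withDensity fun x => ENNReal.ofReal (πm * pm x) := by
    rw [hμm, smul_withDensity_ofReal hpm hπm]
  have hμν : μ = ν.withDensity fun x => ENNReal.ofReal (p x) := by
    rw [hμ, hμp', hμm', ← withDensity_add_left (by fun_prop)]
    congr 1 with x
    exact (ENNReal.ofReal_add (mul_nonneg hπp (hpp0 x)) (mul_nonneg hπm (hpm0 x))).symm
  set a : X → ℝ := fun x => πp * pp x / p x with ha
  set b : X → ℝ := fun x => πm * pm x / p x with hb
  have hameas : Measurable a := by fun_prop
  have hbmeas : Measurable b := by fun_prop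
  have hA0 : ∀ x, 0 ≤ πp * pp x := fun x => mul_nonneg hπp (hpp0 x)
  have hB0 : ∀ x, 0 ≤ πm * pm x := fun x => mul_nonneg hπm (hpm0 x)
  have ha1 : ∀ x, |a x| ≤ 1 := fun x => by
    rw [abs_of_nonneg (div_nonneg (hA0 x) (add_nonneg (hA0 x) (hB0 x)))]
    exact div_le_one_of_le₀ (by linarith [hB0 x]) (add_nonneg (hA0 x) (hB0 x))
  have hb1 : ∀ x, |b x| ≤ 1 := fun x => by
    rw [abs_of_nonneg (div_nonneg (hB0 x) (add_nonneg (hA0 x) (hB0 x)))]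
    exact div_le_one_of_le₀ (by linarith [hA0 x]) (add_nonneg (hA0 x) (hB0 x))
  have hab : ∀ᵐ x ∂μ, a x + b x = 1 := by
    have hac : μ ≪ ν := hμν ▸ withDensity_absolutelyContinuous _ _
    filter_upwards [hac.ae_le hpos] with x hx
    rw [ha, hb, ← add_div, div_self hx.ne']
  have hba : ∀ᵐ x ∂μ, b x + a x = 1 := by simpa only [add_comm] using hab
  have hss : ∀ z : X × X, s z.1 z.2 = a z.1 * a z.2 + b z.1 * b z.2 := fun z => by
    rw [hs, ha, hb, div_mul_div_comm, div_mul_div_comm, ← add_div]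
    congr 1
    ring
  have haint : ∀ H : X → ℝ, ∫ x, a x * H x ∂μ = πp * ∫ x, H x ∂μp := fun H => by
    rw [hμν, ha, integral_div_mul_withDensity hpmeas (by fun_prop) hpos hA0, ← hμp',
      integral_smul_measure, ENNReal.toReal_ofReal hπp, smul_eq_mul]
  have hbint : ∀ H : X → ℝ, ∫ x, b x * H x ∂μ = πm * ∫ x, H x ∂μm := fun H => by
    rw [hμν, hb, integral_div_mul_withDensity hpmeas (by fun_prop) hpos hB0, ← hμm',
      integral_smul_measure, ENNReal.toReal_ofReal hπm, smul_eq_mul]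
  have hπa : ∫ x, a x ∂μ = πp := by simpa using haint fun _ => 1
  have hπb : ∫ x, b x ∂μ = πm := by simpa using hbint fun _ => 1
  have hai := integrable_of_abs_le (P := μ) hameas ha1
  have hbi := integrable_of_abs_le (P := μ) hbmeas hb1
  have hFi := integrable_of_abs_le (P := μ) hF hFM
  have hGi := integrable_of_abs_le (P := μ) hG hGM
  have hmulb : ∀ {v H : X → ℝ}, (∀ x, |v x| ≤ 1) → (∀ x, |H x| ≤ M) → ∀ x, |v x * H x| ≤ 1 * M :=
    fun hv hH x => by
      rw [abs_mul]
      exact mul_le_mul (hv x) (hH x) (abs_nonneg _) zero_le_one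
  have hpos_part := integral_similarity_sub_mul hai hbi hFi
    (integrable_of_abs_le (hameas.mul hF) (hmulb ha1 hFM))
    (integrable_of_abs_le (hbmeas.mul hF) (hmulb hb1 hFM)) hπa hπb hab
  have hneg_part := integral_similarity_sub_mul hbi hai hGi
    (integrable_of_abs_le (hbmeas.mul hG) (hmulb hb1 hGM))
    (integrable_of_abs_le (hameas.mul hG) (hmulb ha1 hGM)) hπb hπa hba
  rw [haint] at hpos_part
  rw [hbint] at hneg_part
  have hsplit : ∀ z : X × X, 1 / (2 * (πp - πm)) * ((s z.1 z.2 - πm) * (F z.1 + F z.2) +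
        (πp - s z.1 z.2) * (G z.1 + G z.2)) =
      1 / (2 * (πp - πm)) * ((a z.1 * a z.2 + b z.1 * b z.2 - πm) * (F z.1 + F z.2) -
        (b z.1 * b z.2 + a z.1 * a z.2 - πp) * (G z.1 + G z.2)) := fun z => by
    rw [hss]; ring
  have hww : ∀ {v w : X → ℝ}, (∀ x, |v x| ≤ 1) → (∀ x, |w x| ≤ 1) → ∀ (r : ℝ) (z : X × X),
      |v z.1 * v z.2 + w z.1 * w z.2 - r| ≤ 2 + |r| := fun hv hw r z => by
    refine (abs_sub _ _).trans (add_le_add_left ((abs_add_le _ _).trans ?_) _)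
    rw [abs_mul, abs_mul]
    have h1 := mul_le_mul (hv z.1) (hv z.2) (abs_nonneg _) zero_le_one
    have h2 := mul_le_mul (hw z.1) (hw z.2) (abs_nonneg _) zero_le_one
    linarith
  have hprodi : ∀ {v w H : X → ℝ}, Measurable v → Measurable w → Measurable H →
      (∀ x, |v x| ≤ 1) → (∀ x, |w x| ≤ 1) → (∀ x, |H x| ≤ M) → ∀ r : ℝ,
      Integrable (fun z : X × X => (v z.1 * v z.2 + w z.1 * w z.2 - r) * (H z.1 + H z.2))
        (μ.prod μ) := fun hvm hwm hHm hv hw hH r =>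
    integrable_of_abs_le (M := (2 + |r|) * (M + M)) (by fun_prop) fun z => by
      rw [abs_mul]
      exact mul_le_mul (hww hv hw r z) ((abs_add_le _ _).trans (add_le_add (hH _) (hH _)))
        (abs_nonneg _) (by positivity)
  simp only [hsplit]
  rw [integral_const_mul, integral_sub (hprodi hameas hbmeas hF ha1 hb1 hFM πm)
    (hprodi hbmeas hameas hG hb1 ha1 hGM πp), hpos_part, hneg_part]
  have : πp - πm ≠ 0 := sub_ne_zero.2 hne
  field_simp
  ring

theorem abs_sub_le_of_lipschitzOnWith {f : ℝ → ℝ} {K C : ℝ} (hK : 0 ≤ K)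
    (hf : LipschitzOnWith (Real.toNNReal K) f (Set.Icc (-C) C)) {t t' : ℝ} (ht : |t| ≤ C)
    (ht' : |t'| ≤ C) : |f t - f t'| ≤ K * |t - t'| := by
  have h := hf.dist_le_mul t (abs_le.1 ht) t' (abs_le.1 ht')
  rwa [Real.dist_eq, Real.dist_eq, Real.coe_toNNReal _ hK] at h

/-- The signed weights of the similarity loss have total absolute mass at most one. -/
theorem abs_similarity_weights_le {w π α β K : ℝ} (hw : w ∈ Set.Icc (0 : ℝ) 1)
    (hπ : π ∈ Set.Icc (0 : ℝ) 1) (hα : |α| ≤ K) (hβ : |β| ≤ K) :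
    |(w - (1 - π)) * α + (π - w) * β| ≤ K := by
  have hK : 0 ≤ K := (abs_nonneg _).trans hα
  have hmass : |w - (1 - π)| + |π - w| ≤ 1 := by
    rcases abs_cases (w - (1 - π)) with h | h <;> rcases abs_cases (π - w) with h' | h' <;>
      linarith [hw.1, hw.2, hπ.1, hπ.2]
  refine (abs_add_le _ _).trans ?_
  rw [abs_mul, abs_mul]
  nlinarith [mul_le_mul_of_nonneg_left hα (abs_nonneg (w - (1 - π))),
    mul_le_mul_of_nonneg_left hβ (abs_nonneg (π - w)), mul_le_mul_of_nonneg_right hmass hK]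

/-- The similarity loss takes values in an interval of length `K`. -/
theorem similarity_loss_mem_Icc {w π α β K : ℝ} (hw : w ∈ Set.Icc (0 : ℝ) 1)
    (hπ : π ∈ Set.Icc (0 : ℝ) 1) (hα : α ∈ Set.Icc 0 K) (hβ : β ∈ Set.Icc 0 K) :
    (w - (1 - π)) * α + (π - w) * β ∈ Set.Icc (-((1 - π) * K)) (π * K) := by
  obtain ⟨hw0, hw1⟩ := hw
  obtain ⟨hπ0, hπ1⟩ := hπ
  obtain ⟨hα0, hα1⟩ := hα
  obtain ⟨hβ0, hβ1⟩ := hβ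
  have hK : 0 ≤ K := hα0.trans hα1
  constructor <;> rcases le_total w (1 - π) with h | h <;> rcases le_total w π with h' | h' <;>
    nlinarith [mul_nonneg (sub_nonneg.2 h) hα0, mul_nonneg (sub_nonneg.2 h) (sub_nonneg.2 hα1),
      mul_nonneg (sub_nonneg.2 h') hβ0, mul_nonneg (sub_nonneg.2 h') (sub_nonneg.2 hβ1),
      mul_nonneg hw0 hK, mul_nonneg (sub_nonneg.2 hw1) hK, mul_nonneg hπ0 hK,
      mul_nonneg (sub_nonneg.2 hπ1) hK]

theorem sconf_estimation_error_bound
    {X : Type*} [MeasurableSpace X] (ν : Measure X) [SigmaFinite ν]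
    (pp pm : X → ℝ) (hppm : Measurable pp) (hpmm : Measurable pm)
    (hpp0 : ∀ x, 0 ≤ pp x) (hpm0 : ∀ x, 0 ≤ pm x)
    (μp μm : Measure X) [IsProbabilityMeasure μp] [IsProbabilityMeasure μm]
    (hμp : μp = ν.withDensity fun x => ENNReal.ofReal (pp x))
    (hμm : μm = ν.withDensity fun x => ENNReal.ofReal (pm x))
    (πp πm : ℝ) (hπp0 : 0 < πp) (hπp1 : πp < 1) (hπm : πm = 1 - πp)
    (hpos : ∀ᵐ x ∂ν, 0 < πp * pp x + πm * pm x)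
    (μ : Measure X) [IsProbabilityMeasure μ]
    (hμ : μ = ENNReal.ofReal πp • μp + ENNReal.ofReal πm • μm)
    (s : X → X → ℝ)
    (hs : ∀ x x', s x x' = (πp ^ 2 * pp x * pp x' + πm ^ 2 * pm x * pm x') /
        ((πp * pp x + πm * pm x) * (πp * pp x' + πm * pm x')))
    (hne : πp ≠ πm)
    (ℓ : ℝ → ℝ → ℝ)
    (hℓm1 : Measurable fun z => ℓ z 1) (hℓm2 : Measurable fun z => ℓ z (-1))
    (hℓ01 : ∀ z, 0 ≤ ℓ z 1) (hℓ02 : ∀ z, 0 ≤ ℓ z (-1))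
    (n : ℕ) (hn : 0 < n)
    (Rhatp Rhatm : (X → ℝ) → (Fin n → X × X) → ℝ)
    (hRhatp : ∀ g ω, Rhatp g ω = (1 / (2 * (n : ℝ) * (πp - πm))) *
        ∑ i, (s (ω i).1 (ω i).2 - πm) * (ℓ (g (ω i).1) 1 + ℓ (g (ω i).2) 1))
    (hRhatm : ∀ g ω, Rhatm g ω = (1 / (2 * (n : ℝ) * (πp - πm))) *
        ∑ i, (πp - s (ω i).1 (ω i).2) * (ℓ (g (ω i).1) (-1) + ℓ (g (ω i).2) (-1)))
    (R : (X → ℝ) → ℝ)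
    (hR : ∀ g, R g = πp * (∫ x, ℓ (g x) 1 ∂μp) + πm * ∫ x, ℓ (g x) (-1) ∂μm)
    (𝒢 : Set (X → ℝ)) (h𝒢ne : 𝒢.Nonempty) (h𝒢c : 𝒢.Countable)
    (h𝒢m : ∀ g ∈ 𝒢, Measurable g)
    (Cg : ℝ) (hCg : 0 < Cg) (h𝒢b : ∀ g ∈ 𝒢, ∀ x, |g x| ≤ Cg)
    (Cl : ℝ) (hCl0 : 0 < Cl)
    (hCl : ∀ z : ℝ, |z| ≤ Cg → ℓ z 1 ≤ Cl ∧ ℓ z (-1) ≤ Cl)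
    (Ll : ℝ) (hLl0 : 0 ≤ Ll)
    (hLl1 : LipschitzOnWith (Real.toNNReal Ll) (fun z => ℓ z 1) (Set.Icc (-Cg) Cg))
    (hLl2 : LipschitzOnWith (Real.toNNReal Ll) (fun z => ℓ z (-1)) (Set.Icc (-Cg) Cg))
    (ρ : Measure ℝ) [IsProbabilityMeasure ρ]
    (hρ : ρ = (2⁻¹ : ℝ≥0∞) • Measure.dirac (1 : ℝ) + (2⁻¹ : ℝ≥0∞) • Measure.dirac (-1 : ℝ))
    (Rad : ℝ)
    (hRad : Rad = ∫ x : Fin n → X, ∫ σ : Fin n → ℝ,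
        (⨆ g ∈ 𝒢, (1 / (n : ℝ)) * ∑ i, σ i * g (x i))
        ∂(Measure.pi fun _ : Fin n => ρ) ∂(Measure.pi fun _ : Fin n => μ))
    (ghat : (Fin n → X × X) → (X → ℝ))
    (hghat : ∀ ω, ghat ω ∈ 𝒢 ∧ ∀ g ∈ 𝒢, Rhatp (ghat ω) ω + Rhatm (ghat ω) ω ≤ Rhatp g ω + Rhatm g ω)
    (gstar : X → ℝ) (hgstar : gstar ∈ 𝒢 ∧ ∀ g ∈ 𝒢, R gstar ≤ R g)
    (δ : ℝ) (hδ : δ ∈ Set.Ioo (0 : ℝ) 1) :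
    ENNReal.ofReal (1 - δ) ≤
      (Measure.pi fun _ : Fin n => μ.prod μ)
        {ω | R (ghat ω) - R gstar ≤
          2 * Ll * Rad / |πp - πm| +
            (2 * Cl / |πp - πm|) * Real.sqrt (Real.log (2 / δ) / (2 * n))} := by
  have hnR : (n : ℝ) ≠ 0 := Nat.cast_ne_zero.2 hn.ne'
  have hΔ : πp - πm ≠ 0 := sub_ne_zero.2 hne
  have hΔ0 : 0 < |πp - πm| := abs_pos.2 hΔ
  have hπ : πp ∈ Set.Icc (0 : ℝ) 1 := ⟨hπp0.le, hπp1.le⟩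
  have hπm0 : 0 ≤ πm := by linarith
  have hs01 : ∀ x x', s x x' ∈ Set.Icc (0 : ℝ) 1 := fun x x' => by
    have h := similarity_mem_Icc (mul_nonneg hπp0.le (hpp0 x)) (mul_nonneg hπm0 (hpm0 x))
      (mul_nonneg hπp0.le (hpp0 x')) (mul_nonneg hπm0 (hpm0 x'))
    rw [hs]
    convert h using 2
    ring
  have hsm : Measurable fun z : X × X => s z.1 z.2 := by
    simp only [hs]
    fun_prop
  set κ : ℝ := 1 / (2 * (πp - πm)) with hκ
  have hκabs : |κ| = 1 / (2 * |πp - πm|) := by rw [hκ, abs_div, abs_mul]; simp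
  set u : X × X → ℝ → ℝ := fun z t =>
    κ * ((s z.1 z.2 - πm) * ℓ t 1 + (πp - s z.1 z.2) * ℓ t (-1)) with hu
  set φ : (X → ℝ) → X × X → ℝ := fun g z =>
    κ * ((s z.1 z.2 - πm) * (ℓ (g z.1) 1 + ℓ (g z.2) 1) +
      (πp - s z.1 z.2) * (ℓ (g z.1) (-1) + ℓ (g z.2) (-1))) with hφ
  have hℓ1 : ∀ t, |t| ≤ Cg → |ℓ t 1| ≤ Cl := fun t ht => by
    rw [abs_of_nonneg (hℓ01 t)]; exact (hCl t ht).1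
  have hℓ2 : ∀ t, |t| ≤ Cg → |ℓ t (-1)| ≤ Cl := fun t ht => by
    rw [abs_of_nonneg (hℓ02 t)]; exact (hCl t ht).2
  have hφm : ∀ g ∈ 𝒢, Measurable (φ g) := fun g hg => by
    have hgm := h𝒢m g hg
    have h1 : Measurable fun x => ℓ (g x) 1 := hℓm1.comp hgm
    have h2 : Measurable fun x => ℓ (g x) (-1) := hℓm2.comp hgm
    have hsum1 : Measurable fun z : X × X => ℓ (g z.1) 1 + ℓ (g z.2) 1 :=
      (h1.comp measurable_fst).add (h1.comp measurable_snd)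
    have hsum2 : Measurable fun z : X × X => ℓ (g z.1) (-1) + ℓ (g z.2) (-1) :=
      (h2.comp measurable_fst).add (h2.comp measurable_snd)
    exact (((hsm.sub_const _).mul hsum1).add ((hsm.const_sub _).mul hsum2)).const_mul _
  have hrisk : ∀ g ∈ 𝒢, R g = ∫ z, φ g z ∂(μ.prod μ) := fun g hg => by
    rw [hR]
    exact (integral_similarity_loss_eq_risk hppm hpmm hpp0 hpm0 hμp hμm hπp0.le hπm0 hpos hμ hs
      hne (hℓm1.comp (h𝒢m g hg)) (hℓm2.comp (h𝒢m g hg)) (fun x => hℓ1 _ (h𝒢b g hg x))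
      fun x => hℓ2 _ (h𝒢b g hg x)).symm
  have hemp : ∀ g ω, Rhatp g ω + Rhatm g ω = 1 / (n : ℝ) * ∑ k, φ g (ω k) := fun g ω => by
    rw [hRhatp, hRhatm, hφ, ← mul_add, ← Finset.sum_add_distrib, ← Finset.mul_sum, ← mul_assoc, hκ]
    congr 1
    field_simp
  have hmin : ∀ ω, ghat ω ∈ 𝒢 ∧ ∑ k, φ (ghat ω) (ω k) ≤ ∑ k, φ gstar (ω k) := fun ω => by
    refine ⟨(hghat ω).1, ?_⟩
    have h := (hghat ω).2 gstar hgstar.1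
    rw [hemp, hemp] at h
    exact le_of_mul_le_mul_left h (by positivity)
  have hubd : ∀ z t, |t| ≤ Cg → |u z t| ≤ |κ| * Cl := fun z t ht => by
    rw [hu, abs_mul, hπm]
    exact mul_le_mul_of_nonneg_left
      (abs_similarity_weights_le (hs01 _ _) hπ (hℓ1 t ht) (hℓ2 t ht)) (abs_nonneg _)
  have hulip : ∀ z t t', |t| ≤ Cg → |t'| ≤ Cg → |u z t - u z t'| ≤ |κ| * Ll * |t - t'| :=
    fun z t t' ht ht' => by
      have h := abs_similarity_weights_le (hs01 z.1 z.2) hπ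
        (abs_sub_le_of_lipschitzOnWith hLl0 hLl1 ht ht')
        (abs_sub_le_of_lipschitzOnWith hLl0 hLl2 ht ht')
      have hdiff : u z t - u z t' = κ * ((s z.1 z.2 - (1 - πp)) * (ℓ t 1 - ℓ t' 1) +
          (πp - s z.1 z.2) * (ℓ t (-1) - ℓ t' (-1))) := by
        rw [hu, hπm]; ring
      rw [hdiff, abs_mul, mul_assoc]
      exact mul_le_mul_of_nonneg_left h (abs_nonneg _)
  have hosc : ∀ g ∈ 𝒢, ∀ z z', φ g z ≤ φ g z' + |κ| * (2 * Cl) := fun g hg z z' => by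
    have hα : ∀ z : X × X, ℓ (g z.1) 1 + ℓ (g z.2) 1 ∈ Set.Icc 0 (2 * Cl) := fun z =>
      ⟨add_nonneg (hℓ01 _) (hℓ01 _),
        by linarith [(hCl _ (h𝒢b g hg z.1)).1, (hCl _ (h𝒢b g hg z.2)).1]⟩
    have hβ : ∀ z : X × X, ℓ (g z.1) (-1) + ℓ (g z.2) (-1) ∈ Set.Icc 0 (2 * Cl) := fun z =>
      ⟨add_nonneg (hℓ02 _) (hℓ02 _),
        by linarith [(hCl _ (h𝒢b g hg z.1)).2, (hCl _ (h𝒢b g hg z.2)).2]⟩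
    have h := similarity_loss_mem_Icc (hs01 z.1 z.2) hπ (hα z) (hβ z)
    have h' := similarity_loss_mem_Icc (hs01 z'.1 z'.2) hπ (hα z') (hβ z')
    rw [← sub_le_iff_le_add', hφ, ← mul_sub]
    refine (le_abs_self _).trans ?_
    rw [abs_mul]
    refine mul_le_mul_of_nonneg_left (abs_le.2 ?_) (abs_nonneg _)
    rw [hπm]
    constructor <;> linarith [h.1, h.2, h'.1, h'.2]
  have hκ0 : 0 < |κ| := by rw [hκabs]; positivity
  have hmain := le_measure_excess_risk (μ := μ) (u := u) (φ := φ) hρ h𝒢c h𝒢m h𝒢b hn hφm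
    (fun g z => by simp only [hφ, hu]; ring) hubd (by positivity) hulip
    (c := |κ| * (2 * Cl)) (by positivity) hosc hgstar.1 hmin hδ
  refine hmain.trans (measure_mono fun ω hω => ?_)
  rw [Set.mem_ofPred_eq, ← hrisk _ (hghat ω).1, ← hrisk _ hgstar.1, ← hRad, hκabs] at hω
  rw [Set.mem_ofPred_eq]
  convert hω using 2
  · field_simp
    ring
  · field_simp
end

section
/- Unbiasedness of the class-prior estimator (Theorem 5, unbiasedness part): The expectation of the similarity confidence under a pair of independent draws from the marginal distribution equals π₊² + π₋², i.e., ∫∫ s(x,x') dμ(x) dμ(x') = π₊² + π₋². -/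
open MeasureTheory ProbabilityTheory
open scoped ENNReal BigOperators

/-- A nonnegative function whose associated density defines a probability measure is integrable. -/
lemma integrable_of_withDensity_ofReal {X : Type*} [MeasurableSpace X] {ν : Measure X}
    {a : X → ℝ} (ha : Measurable a) (ha0 : ∀ x, 0 ≤ a x)
    (h : IsProbabilityMeasure (ν.withDensity fun x => ENNReal.ofReal (a x))) :
    Integrable a ν := by
  refine (lintegral_ofReal_ne_top_iff_integrable ha.aestronglyMeasurable
    (Filter.Eventually.of_forall ha0)).1 ?_
  rw [← setLIntegral_univ, ← withDensity_apply _ MeasurableSet.univ]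
  exact measure_ne_top _ _

lemma integral_eq_one_of_withDensity_ofReal {X : Type*} [MeasurableSpace X] {ν : Measure X}
    {a : X → ℝ} (ha : Measurable a) (ha0 : ∀ x, 0 ≤ a x)
    (h : IsProbabilityMeasure (ν.withDensity fun x => ENNReal.ofReal (a x))) :
    ∫ x, a x ∂ν = 1 := by
  rw [integral_eq_lintegral_of_nonneg_ae (Filter.Eventually.of_forall ha0)
    ha.aestronglyMeasurable, ← setLIntegral_univ, ← withDensity_apply _ MeasurableSet.univ,
    measure_univ, ENNReal.toReal_one]

lemma integrable_div_withDensity_ofReal {X : Type*} [MeasurableSpace X] {ν : Measure X}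
    {a p : X → ℝ} (hp : Measurable p) (hpos : ∀ᵐ x ∂ν, 0 < p x) (ha : Integrable a ν) :
    Integrable (fun x => a x / p x) (ν.withDensity fun x => ENNReal.ofReal (p x)) := by
  rw [integrable_withDensity_iff hp.ennreal_ofReal
    (Filter.Eventually.of_forall fun _ => ENNReal.ofReal_lt_top)]
  refine ha.congr ?_
  filter_upwards [hpos] with x hx
  rw [ENNReal.toReal_ofReal hx.le, div_mul_cancel₀ _ hx.ne']

lemma integral_div_withDensity_ofReal {X : Type*} [MeasurableSpace X] {ν : Measure X}
    {a p : X → ℝ} (hp : Measurable p) (hpos : ∀ᵐ x ∂ν, 0 < p x) :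
    ∫ x, a x / p x ∂(ν.withDensity fun x => ENNReal.ofReal (p x)) = ∫ x, a x ∂ν := by
  rw [integral_withDensity_eq_integral_toReal_smul hp.ennreal_ofReal
    (Filter.Eventually.of_forall fun _ => ENNReal.ofReal_lt_top)]
  refine integral_congr_ae ?_
  filter_upwards [hpos] with x hx
  rw [ENNReal.toReal_ofReal hx.le, smul_eq_mul, mul_div_cancel₀ _ hx.ne']

theorem sconf_class_prior_unbiased
    {X : Type*} [MeasurableSpace X] (ν : Measure X) [SigmaFinite ν]
    (pp pm : X → ℝ) (hppm : Measurable pp) (hpmm : Measurable pm)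
    (hpp0 : ∀ x, 0 ≤ pp x) (hpm0 : ∀ x, 0 ≤ pm x)
    (μp μm : Measure X) [IsProbabilityMeasure μp] [IsProbabilityMeasure μm]
    (hμp : μp = ν.withDensity fun x => ENNReal.ofReal (pp x))
    (hμm : μm = ν.withDensity fun x => ENNReal.ofReal (pm x))
    (πp πm : ℝ) (hπp0 : 0 < πp) (hπp1 : πp < 1) (hπm : πm = 1 - πp)
    (hpos : ∀ᵐ x ∂ν, 0 < πp * pp x + πm * pm x)
    (μ : Measure X) [IsProbabilityMeasure μ]
    (hμ : μ = ENNReal.ofReal πp • μp + ENNReal.ofReal πm • μm)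
    (s : X → X → ℝ)
    (hs : ∀ x x', s x x' = (πp ^ 2 * pp x * pp x' + πm ^ 2 * pm x * pm x') /
        ((πp * pp x + πm * pm x) * (πp * pp x' + πm * pm x')))
    :
    (∫ x, ∫ x', s x x' ∂μ ∂μ) = πp ^ 2 + πm ^ 2 := by
  have hπm0 : 0 ≤ πm := by linarith
  have hp : Measurable fun x => πp * pp x + πm * pm x := by fun_prop
  have hμp' : IsProbabilityMeasure (ν.withDensity fun x => ENNReal.ofReal (pp x)) :=
    hμp ▸ inferInstance
  have hμm' : IsProbabilityMeasure (ν.withDensity fun x => ENNReal.ofReal (pm x)) :=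
    hμm ▸ inferInstance
  have hμν : μ = ν.withDensity fun x => ENNReal.ofReal (πp * pp x + πm * pm x) := by
    rw [hμ, hμp, hμm, ← withDensity_smul _ hppm.ennreal_ofReal,
      ← withDensity_smul _ hpmm.ennreal_ofReal,
      ← withDensity_add_left (hppm.ennreal_ofReal.const_smul _)]
    congr 1
    ext x
    simp only [Pi.add_apply, Pi.smul_apply, smul_eq_mul]
    rw [ENNReal.ofReal_add (mul_nonneg hπp0.le (hpp0 x)) (mul_nonneg hπm0 (hpm0 x)),
      ENNReal.ofReal_mul hπp0.le, ENNReal.ofReal_mul hπm0]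
  set p : X → ℝ := fun x => πp * pp x + πm * pm x
  have hip : Integrable (fun x => pp x / p x) μ := hμν ▸ integrable_div_withDensity_ofReal hp hpos
    (integrable_of_withDensity_ofReal hppm hpp0 hμp')
  have him : Integrable (fun x => pm x / p x) μ := hμν ▸ integrable_div_withDensity_ofReal hp hpos
    (integrable_of_withDensity_ofReal hpmm hpm0 hμm')
  have hIp : ∫ x, pp x / p x ∂μ = 1 := by
    rw [hμν, integral_div_withDensity_ofReal hp hpos,
      integral_eq_one_of_withDensity_ofReal hppm hpp0 hμp']
  have hIm : ∫ x, pm x / p x ∂μ = 1 := by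
    rw [hμν, integral_div_withDensity_ofReal hp hpos,
      integral_eq_one_of_withDensity_ofReal hpmm hpm0 hμm']
  have hlin (c d : ℝ) : ∫ x, (c * (pp x / p x) + d * (pm x / p x)) ∂μ = c + d := by
    rw [integral_add (hip.const_mul c) (him.const_mul d), integral_const_mul, integral_const_mul,
      hIp, hIm, mul_one, mul_one]
  have hs' (x x' : X) : s x x' = πp ^ 2 * (pp x / p x) * (pp x' / p x') +
      πm ^ 2 * (pm x / p x) * (pm x' / p x') := by
    simp only [hs, p, div_eq_mul_inv, mul_inv]
    ring
  simp_rw [hs', hlin]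
end

section
/- Consistency of the corrected risk estimator (Theorem 7): Fix a measurable classifier g: 𝒳 → ℝ such that ℓ(g(x),y) ≤ C_ℓ for all x ∈ 𝒳 and y ∈ {−1,+1}, and suppose there exist α > 0 and β > 0 with R₊(g) ≥ α and R₋(g) ≥ β. Then 0 ≤ E[R̃(g)] − R(g) ≤ (2·(L_f+1)·C_ℓ/|π₊−π₋|)·(exp(−α²·(π₊−π₋)²·n/(2·C_ℓ²)) + exp(−β²·(π₊−π₋)²·n/(2·C_ℓ²))), where the expectation is over the draw of the n i.i.d. pairs; in particular the bias of the corrected estimator is nonnegative and decays exponentially in n. -/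
open MeasureTheory ProbabilityTheory
open scoped ENNReal BigOperators

/-- **Hoeffding's inequality** on a finite power of a probability space: a sum of bounded
i.i.d. variables with mean at least `α` is negative with exponentially small probability. -/
lemma measureReal_pi_sum_neg_le {S : Type*} [MeasurableSpace S] (P : Measure S)
    [IsProbabilityMeasure P] {Z : S → ℝ} (hZ : Measurable Z) {M α : ℝ} (hM : 0 < M)
    (hα : 0 < α) (hZM : ∀ x, |Z x| ≤ M) (hmean : α ≤ ∫ x, Z x ∂P) {n : ℕ} (hn : 0 < n) :
    (Measure.pi fun _ : Fin n => P).real {ω | ∑ i, Z (ω i) < 0} ≤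
      Real.exp (-(α ^ 2) * n / (2 * M ^ 2)) := by
  have hn' : (0 : ℝ) < n := by exact_mod_cast hn
  have hsub : HasSubgaussianMGF (-fun x => Z x - P[Z]) ((‖M - -M‖₊ / 2) ^ 2) P :=
    (hasSubgaussianMGF_of_mem_Icc hZ.aemeasurable (ae_of_all _ fun x => abs_le.1 (hZM x))).neg
  have hmeas : Measurable (-fun x => Z x - P[Z]) := (hZ.sub_const _).neg
  have hind : iIndepFun (fun (i : Fin n) ω => (-fun x => Z x - P[Z]) (ω i))
      (Measure.pi fun _ : Fin n => P) := iIndepFun_pi fun _ => hmeas.aemeasurable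
  have hsub' (i : Fin n) : HasSubgaussianMGF (fun ω : Fin n → S => (-fun x => Z x - P[Z]) (ω i))
      ((‖M - -M‖₊ / 2) ^ 2) (Measure.pi fun _ : Fin n => P) := by
    have hmp := measurePreserving_eval (fun _ : Fin n => P) i
    refine HasSubgaussianMGF.of_map (Y := Function.eval i) hmp.measurable.aemeasurable ?_
    rwa [hmp.map_eq]
  have hoeffding := HasSubgaussianMGF.measure_sum_ge_le_of_iIndepFun hind
    (s := Finset.univ) (fun i _ => hsub' i) (ε := n * α) (by positivity)
  refine (measureReal_mono fun ω hω => ?_).trans (hoeffding.trans_eq ?_)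
  · have hω' : ∑ i, Z (ω i) < 0 := hω
    have : n * α ≤ n * P[Z] := by gcongr
    simp only [Set.mem_ofPred_eq, Pi.neg_apply, neg_sub, Finset.sum_sub_distrib,
      Finset.sum_const, Finset.card_univ, Fintype.card_fin, nsmul_eq_mul]
    linarith
  · have hnorm : ‖M - -M‖ / 2 = M := by
      rw [Real.norm_of_nonneg (by linarith)]; ring
    simp only [Finset.sum_const, Finset.card_univ, Fintype.card_fin, nsmul_eq_mul, NNReal.coe_mul,
      NNReal.coe_pow, NNReal.coe_div, coe_nnnorm, NNReal.coe_natCast, NNReal.coe_ofNat, hnorm]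
    congr 1
    field_simp

/-- Replacing the negative part of an empirical mean by a multiple `k` of its absolute value
introduces a nonnegative and exponentially small bias. -/
lemma integral_pi_corrected_mean_sub_mem {S : Type*} [MeasurableSpace S] (P : Measure S)
    [IsProbabilityMeasure P] {Z : S → ℝ} (hZ : Measurable Z) {M α k : ℝ} (hM : 0 < M)
    (hα : 0 < α) (hk : 0 < k) (hZM : ∀ x, |Z x| ≤ M) (hmean : α ≤ ∫ x, Z x ∂P)
    {n : ℕ} (hn : 0 < n) {f : ℝ → ℝ} (hf : ∀ x, f x = if 0 ≤ x then x else k * |x|)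
    {Y : (Fin n → S) → ℝ} (hY : ∀ ω, Y ω = (1 / n) * ∑ i, Z (ω i)) :
    Integrable (fun ω => f (Y ω)) (Measure.pi fun _ : Fin n => P) ∧
    (∫ ω, f (Y ω) ∂(Measure.pi fun _ : Fin n => P)) - ∫ x, Z x ∂P ∈
      Set.Icc 0 ((k + 1) * M * Real.exp (-(α ^ 2) * n / (2 * M ^ 2))) := by
  have hn' : (0 : ℝ) < n := by exact_mod_cast hn
  have hfm : Measurable f := by
    rw [funext hf]
    exact Measurable.ite measurableSet_Ici measurable_id (by fun_prop)
  have hsm : Measurable fun ω : Fin n → S => ∑ i, Z (ω i) := by fun_prop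
  have hYm : Measurable Y := by
    rw [funext hY]; fun_prop
  have hYM (ω) : |Y ω| ≤ M := by
    rw [hY, abs_mul, abs_of_pos (by positivity : (0 : ℝ) < 1 / n)]
    calc 1 / (n : ℝ) * |∑ i, Z (ω i)| ≤ 1 / n * ∑ i : Fin n, M := by
          gcongr
          exact (Finset.abs_sum_le_sum_abs _ _).trans (Finset.sum_le_sum fun i _ => hZM _)
      _ = M := by simp; field_simp
  have hZint : Integrable Z P := Integrable.of_bound hZ.aestronglyMeasurable M (ae_of_all _ hZM)
  have hYint : Integrable Y (Measure.pi fun _ : Fin n => P) :=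
    Integrable.of_bound hYm.aestronglyMeasurable M (ae_of_all _ hYM)
  have hfint : Integrable (fun ω => f (Y ω)) (Measure.pi fun _ : Fin n => P) := by
    refine Integrable.of_bound (hfm.comp hYm).aestronglyMeasurable ((k + 1) * M)
      (ae_of_all _ fun ω => ?_)
    rw [Real.norm_eq_abs, hf]
    have h0 := abs_nonneg (Y ω)
    have h1 := hYM ω
    split_ifs
    · nlinarith
    · rw [abs_mul, abs_abs, abs_of_pos hk]; nlinarith
  have hYmean : ∫ ω, Y ω ∂(Measure.pi fun _ : Fin n => P) = ∫ x, Z x ∂P := by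
    simp_rw [hY]
    rw [integral_const_mul, integral_finsetSum]
    · simp_rw [integral_comp_eval (μ := fun _ : Fin n => P) hZ.aestronglyMeasurable]
      simp; field_simp
    · exact fun i _ => integrable_comp_eval (μ := fun _ : Fin n => P) hZint
  have hset : MeasurableSet {ω : Fin n → S | ∑ i, Z (ω i) < 0} :=
    measurableSet_lt hsm measurable_const
  refine ⟨hfint, ?_⟩
  rw [← hYmean, ← integral_sub hfint hYint]
  refine ⟨integral_nonneg fun ω => ?_, ?_⟩
  · simp only [Pi.zero_apply, hf]
    split_ifs with h
    · simp
    · have := mul_nonneg hk.le (abs_nonneg (Y ω)); linarith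
  · calc _ ≤ ∫ ω, {ω : Fin n → S | ∑ i, Z (ω i) < 0}.indicator (fun _ => (k + 1) * M) ω
          ∂(Measure.pi fun _ : Fin n => P) := by
          refine integral_mono (hfint.sub hYint) ((integrable_const _).indicator hset) fun ω => ?_
          by_cases h : ∑ i, Z (ω i) < 0
          · have hneg : Y ω < 0 := by rw [hY]; exact mul_neg_of_pos_of_neg (by positivity) h
            have h1 := hYM ω
            rw [Set.indicator_of_mem (by exact h)]
            simp only [hf, hneg.not_ge, if_false]
            rw [abs_of_neg hneg] at h1 ⊢
            nlinarith
          · have hnn : 0 ≤ Y ω := by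
              rw [hY]; exact mul_nonneg (by positivity) (not_lt.1 h)
            rw [Set.indicator_of_notMem (by exact h)]
            simp [hf, hnn]
      _ = (k + 1) * M * (Measure.pi fun _ : Fin n => P).real {ω | ∑ i, Z (ω i) < 0} := by
          rw [integral_indicator_const _ hset, smul_eq_mul, mul_comm]
      _ ≤ _ := by
          gcongr
          exact measureReal_pi_sum_neg_le P hZ hM hα hZM hmean hn

lemma withDensity_mixture {X : Type*} [MeasurableSpace X] (ν : Measure X) {p q : X → ℝ}
    (hp : Measurable p) (hq : Measurable q) (hp0 : ∀ x, 0 ≤ p x) (hq0 : ∀ x, 0 ≤ q x)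
    {a b : ℝ} (ha : 0 < a) (hb : 0 < b) :
    ENNReal.ofReal a • ν.withDensity (fun x => ENNReal.ofReal (p x)) +
      ENNReal.ofReal b • ν.withDensity (fun x => ENNReal.ofReal (q x)) =
    ν.withDensity fun x => ENNReal.ofReal (a * p x + b * q x) := by
  rw [← withDensity_smul _ hp.ennreal_ofReal, ← withDensity_smul _ hq.ennreal_ofReal,
    ← withDensity_add_left (hp.ennreal_ofReal.const_smul _)]
  congr 1
  funext x
  simp only [Pi.add_apply, Pi.smul_apply, smul_eq_mul]
  rw [ENNReal.ofReal_add (mul_nonneg ha.le (hp0 x)) (mul_nonneg hb.le (hq0 x)),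
    ENNReal.ofReal_mul ha.le, ENNReal.ofReal_mul hb.le]

lemma integral_density_ratio_mul {X : Type*} [MeasurableSpace X] (ν : Measure X) {p w : X → ℝ}
    (hp : Measurable p) (hw : Measurable w) (hp0 : ∀ x, 0 ≤ p x) (hpos : ∀ᵐ x ∂ν, 0 < w x)
    (F : X → ℝ) :
    ∫ x, p x / w x * F x ∂(ν.withDensity fun x => ENNReal.ofReal (w x)) =
      ∫ x, F x ∂(ν.withDensity fun x => ENNReal.ofReal (p x)) := by
  rw [integral_withDensity_eq_integral_toReal_smul hw.ennreal_ofReal (by simp),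
    integral_withDensity_eq_integral_toReal_smul hp.ennreal_ofReal (by simp)]
  refine integral_congr_ae (hpos.mono fun x hx => ?_)
  simp only [smul_eq_mul]
  rw [ENNReal.toReal_ofReal hx.le, ENNReal.toReal_ofReal (hp0 x)]
  field_simp

/-- Mean of a similarity-weighted function of a pair, when the density ratios `u`, `v` turn
`μ` into `μ₁`, `μ₂`. -/
lemma integral_prod_similarity_weight {X : Type*} [MeasurableSpace X] {μ μ₁ μ₂ : Measure X}
    [IsProbabilityMeasure μ] [IsProbabilityMeasure μ₁] [IsProbabilityMeasure μ₂]
    {u v h : X → ℝ} (hu : Integrable u μ) (hv : Integrable v μ) (hh : Integrable h μ)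
    (huh : Integrable (fun x => u x * h x) μ) (hvh : Integrable (fun x => v x * h x) μ)
    (hu' : ∀ F : X → ℝ, ∫ x, u x * F x ∂μ = ∫ x, F x ∂μ₁)
    (hv' : ∀ F : X → ℝ, ∫ x, v x * F x ∂μ = ∫ x, F x ∂μ₂)
    {a b : ℝ} (hab : a + b = 1) (hmix : ∫ x, h x ∂μ = a * ∫ x, h x ∂μ₁ + b * ∫ x, h x ∂μ₂) :
    ∫ z, (a ^ 2 * (u z.1 * u z.2) + b ^ 2 * (v z.1 * v z.2) - b) * (h z.1 + h z.2) ∂(μ.prod μ) =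
      2 * (a - b) * (a * ∫ x, h x ∂μ₁) := by
  have hu1 : ∫ x, u x ∂μ = 1 := by simpa using hu' fun _ => 1
  have hv1 : ∫ x, v x ∂μ = 1 := by simpa using hv' fun _ => 1
  have e1 := (huh.mul_prod hu).const_mul (a ^ 2)
  have e2 := (hu.mul_prod huh).const_mul (a ^ 2)
  have e3 := (hvh.mul_prod hv).const_mul (b ^ 2)
  have e4 := (hv.mul_prod hvh).const_mul (b ^ 2)
  have e5 := (hh.comp_fst μ).const_mul b
  have e6 := (hh.comp_snd μ).const_mul b
  have expand : (fun z : X × X =>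
      (a ^ 2 * (u z.1 * u z.2) + b ^ 2 * (v z.1 * v z.2) - b) * (h z.1 + h z.2)) = fun z =>
      a ^ 2 * (u z.1 * h z.1 * u z.2) + a ^ 2 * (u z.1 * (u z.2 * h z.2)) +
        b ^ 2 * (v z.1 * h z.1 * v z.2) + b ^ 2 * (v z.1 * (v z.2 * h z.2)) -
        b * h z.1 - b * h z.2 := by
    funext z; ring
  have e12 := e1.add e2
  have e123 := e12.add e3
  have e1234 := e123.add e4
  rw [expand, integral_sub (by exact e1234.sub e5) e6, integral_sub (by exact e1234) e5,
    integral_add (by exact e123) e4, integral_add (by exact e12) e3, integral_add e1 e2]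
  simp only [integral_const_mul]
  rw [integral_prod_mul (fun x => u x * h x) u, integral_prod_mul u (fun x => u x * h x),
    integral_prod_mul (fun x => v x * h x) v, integral_prod_mul v (fun x => v x * h x),
    integral_fun_fst, integral_fun_snd, hu', hv', hu1, hv1, hmix]
  simp only [probReal_univ, smul_eq_mul]
  obtain rfl : b = 1 - a := by linarith
  ring

lemma similarity_confidence_mem_Icc {a b p q p' q' : ℝ} (ha : 0 < a) (hb : 0 < b) (hp : 0 ≤ p)
    (hq : 0 ≤ q) (hp' : 0 ≤ p') (hq' : 0 ≤ q') :
    (a ^ 2 * p * p' + b ^ 2 * q * q') / ((a * p + b * q) * (a * p' + b * q')) ∈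
      Set.Icc (0 : ℝ) 1 := by
  refine ⟨by positivity, div_le_one_of_le₀ ?_ (by positivity)⟩
  have h1 : 0 ≤ a * b * (p * q') := by positivity
  have h2 : 0 ≤ a * b * (q * p') := by positivity
  linarith

/-- Bias of the corrected empirical risk of a single class, for the class with density `p` and
prior `a`; the loss of the classifier on this class is `h`. -/
lemma sconf_class_risk_bias {X : Type*} [MeasurableSpace X] (ν : Measure X)
    {p q : X → ℝ} (hp : Measurable p) (hq : Measurable q) (hp0 : ∀ x, 0 ≤ p x)
    (hq0 : ∀ x, 0 ≤ q x) {μ μ₁ μ₂ : Measure X} [IsProbabilityMeasure μ]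
    [IsProbabilityMeasure μ₁] [IsProbabilityMeasure μ₂]
    (hμ₁ : μ₁ = ν.withDensity fun x => ENNReal.ofReal (p x))
    (hμ₂ : μ₂ = ν.withDensity fun x => ENNReal.ofReal (q x))
    {a b : ℝ} (ha : 0 < a) (hb : 0 < b) (hab : a + b = 1) (hne : a ≠ b)
    (hpos : ∀ᵐ x ∂ν, 0 < a * p x + b * q x)
    (hμ : μ = ENNReal.ofReal a • μ₁ + ENNReal.ofReal b • μ₂)
    {s : X → X → ℝ}
    (hs : ∀ x x', s x x' = (a ^ 2 * p x * p x' + b ^ 2 * q x * q x') /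
        ((a * p x + b * q x) * (a * p x' + b * q x')))
    {h : X → ℝ} (hh : Measurable h) (hh0 : ∀ x, 0 ≤ h x) {C : ℝ} (hC : 0 < C)
    (hhC : ∀ x, h x ≤ C) {n : ℕ} (hn : 0 < n) {Y : (Fin n → X × X) → ℝ}
    (hY : ∀ ω, Y ω = (1 / (2 * (n : ℝ) * (a - b))) *
        ∑ i, (s (ω i).1 (ω i).2 - b) * (h (ω i).1 + h (ω i).2))
    {k : ℝ} (hk : 0 < k) {f : ℝ → ℝ} (hf : ∀ x, f x = if 0 ≤ x then x else k * |x|)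
    {α : ℝ} (hα : 0 < α) (hR : α ≤ a * ∫ x, h x ∂μ₁) :
    Integrable (fun ω => f (Y ω)) (Measure.pi fun _ : Fin n => μ.prod μ) ∧
    (∫ ω, f (Y ω) ∂(Measure.pi fun _ : Fin n => μ.prod μ)) - a * ∫ x, h x ∂μ₁ ∈
      Set.Icc 0 ((k + 1) * (C / |a - b|) *
        Real.exp (-(α ^ 2) * (a - b) ^ 2 * n / (2 * C ^ 2))) := by
  have hd : 0 < |a - b| := abs_pos.2 (sub_ne_zero.2 hne)
  have hd' : a - b ≠ 0 := sub_ne_zero.2 hne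
  have hw : Measurable fun x => a * p x + b * q x := by fun_prop
  have hμw : μ = ν.withDensity fun x => ENNReal.ofReal (a * p x + b * q x) := by
    rw [hμ, hμ₁, hμ₂, withDensity_mixture ν hp hq hp0 hq0 ha hb]
  have hum : Measurable fun x => p x / (a * p x + b * q x) := hp.div hw
  have hvm : Measurable fun x => q x / (a * p x + b * q x) := hq.div hw
  have hub (x) : ‖p x / (a * p x + b * q x)‖ ≤ 1 / a := by
    have h1 := mul_nonneg ha.le (hp0 x)
    have h2 := mul_nonneg hb.le (hq0 x)
    rw [Real.norm_of_nonneg (div_nonneg (hp0 x) (by linarith)), le_div_iff₀ ha, div_mul_eq_mul_div]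
    exact div_le_one_of_le₀ (by linarith) (by linarith)
  have hvb (x) : ‖q x / (a * p x + b * q x)‖ ≤ 1 / b := by
    have h1 := mul_nonneg ha.le (hp0 x)
    have h2 := mul_nonneg hb.le (hq0 x)
    rw [Real.norm_of_nonneg (div_nonneg (hq0 x) (by linarith)), le_div_iff₀ hb, div_mul_eq_mul_div]
    exact div_le_one_of_le₀ (by linarith) (by linarith)
  have hhb (x) : ‖h x‖ ≤ C := by rw [Real.norm_of_nonneg (hh0 x)]; exact hhC x
  have hhint (P : Measure X) [IsProbabilityMeasure P] : Integrable h P :=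
    Integrable.of_bound hh.aestronglyMeasurable C (ae_of_all _ hhb)
  have hmix : ∫ x, h x ∂μ = a * ∫ x, h x ∂μ₁ + b * ∫ x, h x ∂μ₂ := by
    rw [hμ, integral_add_measure ((hhint μ₁).smul_measure (by simp))
      ((hhint μ₂).smul_measure (by simp)), integral_smul_measure, integral_smul_measure,
      ENNReal.toReal_ofReal ha.le, ENNReal.toReal_ofReal hb.le, smul_eq_mul, smul_eq_mul]
  have hmean : ∫ z, (s z.1 z.2 - b) * (h z.1 + h z.2) ∂(μ.prod μ) =
      2 * (a - b) * (a * ∫ x, h x ∂μ₁) := by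
    rw [← integral_prod_similarity_weight (μ := μ) (μ₁ := μ₁) (μ₂ := μ₂)
      (u := fun x => p x / (a * p x + b * q x)) (v := fun x => q x / (a * p x + b * q x))
      (Integrable.of_bound hum.aestronglyMeasurable _ (ae_of_all _ hub))
      (Integrable.of_bound hvm.aestronglyMeasurable _ (ae_of_all _ hvb)) (hhint μ)
      ((hhint μ).bdd_mul hum.aestronglyMeasurable (ae_of_all _ hub))
      ((hhint μ).bdd_mul hvm.aestronglyMeasurable (ae_of_all _ hvb))
      (fun F => by rw [hμw, hμ₁]; exact integral_density_ratio_mul ν hp hw hp0 hpos F)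
      (fun F => by rw [hμw, hμ₂]; exact integral_density_ratio_mul ν hq hw hq0 hpos F) hab hmix]
    congr 1
    funext z
    simp only [hs, div_eq_mul_inv, mul_inv]
    ring
  have hsm : Measurable fun z : X × X => s z.1 z.2 := by
    simp_rw [hs]; fun_prop
  have hZmean : ∫ z, (s z.1 z.2 - b) * (h z.1 + h z.2) / (2 * (a - b)) ∂(μ.prod μ) =
      a * ∫ x, h x ∂μ₁ := by
    rw [integral_div, hmean]; field_simp
  have key := integral_pi_corrected_mean_sub_mem (μ.prod μ)
    (Z := fun z => (s z.1 z.2 - b) * (h z.1 + h z.2) / (2 * (a - b))) (by fun_prop)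
    (M := C / |a - b|) (div_pos hC hd) hα hk (fun z => ?_) (hZmean.symm ▸ hR) hn hf (Y := Y)
    (fun ω => ?_)
  · rw [hZmean] at key
    convert key using 5
    rw [div_pow, sq_abs]
    field_simp
  · obtain ⟨hs0, hs1⟩ : s z.1 z.2 ∈ Set.Icc (0 : ℝ) 1 := by
      rw [hs]
      exact similarity_confidence_mem_Icc ha hb (hp0 _) (hq0 _) (hp0 _) (hq0 _)
    have hsb : |s z.1 z.2 - b| ≤ 1 := abs_le.2 ⟨by linarith, by linarith⟩
    have hhh : |h z.1 + h z.2| ≤ 2 * C := by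
      rw [abs_of_nonneg (add_nonneg (hh0 _) (hh0 _))]
      linarith [hhC z.1, hhC z.2]
    rw [abs_div, abs_mul, abs_mul, abs_two]
    calc |s z.1 z.2 - b| * |h z.1 + h z.2| / (2 * |a - b|)
        ≤ 1 * (2 * C) / (2 * |a - b|) := by gcongr
      _ = C / |a - b| := by field_simp
  · rw [hY, ← Finset.sum_div]
    field_simp

theorem sconf_corrected_estimator_consistency
    {X : Type*} [MeasurableSpace X] (ν : Measure X) [SigmaFinite ν]
    (pp pm : X → ℝ) (hppm : Measurable pp) (hpmm : Measurable pm)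
    (hpp0 : ∀ x, 0 ≤ pp x) (hpm0 : ∀ x, 0 ≤ pm x)
    (μp μm : Measure X) [IsProbabilityMeasure μp] [IsProbabilityMeasure μm]
    (hμp : μp = ν.withDensity fun x => ENNReal.ofReal (pp x))
    (hμm : μm = ν.withDensity fun x => ENNReal.ofReal (pm x))
    (πp πm : ℝ) (hπp0 : 0 < πp) (hπp1 : πp < 1) (hπm : πm = 1 - πp)
    (hpos : ∀ᵐ x ∂ν, 0 < πp * pp x + πm * pm x)
    (μ : Measure X) [IsProbabilityMeasure μ]
    (hμ : μ = ENNReal.ofReal πp • μp + ENNReal.ofReal πm • μm)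
    (s : X → X → ℝ)
    (hs : ∀ x x', s x x' = (πp ^ 2 * pp x * pp x' + πm ^ 2 * pm x * pm x') /
        ((πp * pp x + πm * pm x) * (πp * pp x' + πm * pm x')))
    (hne : πp ≠ πm)
    (ℓ : ℝ → ℝ → ℝ)
    (hℓm1 : Measurable fun z => ℓ z 1) (hℓm2 : Measurable fun z => ℓ z (-1))
    (hℓ01 : ∀ z, 0 ≤ ℓ z 1) (hℓ02 : ∀ z, 0 ≤ ℓ z (-1))
    (g : X → ℝ) (hg : Measurable g)
    (n : ℕ) (hn : 0 < n)
    (Rhatp Rhatm : (X → ℝ) → (Fin n → X × X) → ℝ)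
    (hRhatp : ∀ g ω, Rhatp g ω = (1 / (2 * (n : ℝ) * (πp - πm))) *
        ∑ i, (s (ω i).1 (ω i).2 - πm) * (ℓ (g (ω i).1) 1 + ℓ (g (ω i).2) 1))
    (hRhatm : ∀ g ω, Rhatm g ω = (1 / (2 * (n : ℝ) * (πp - πm))) *
        ∑ i, (πp - s (ω i).1 (ω i).2) * (ℓ (g (ω i).1) (-1) + ℓ (g (ω i).2) (-1)))
    (k : ℝ) (hk : 0 < k)
    (f : ℝ → ℝ) (hf : ∀ x, f x = if 0 ≤ x then x else k * |x|)
    (Lf : ℝ) (hLf : Lf = max 1 k)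
    (Cl : ℝ) (hCl0 : 0 < Cl)
    (hgb : ∀ x, ℓ (g x) 1 ≤ Cl ∧ ℓ (g x) (-1) ≤ Cl)
    (α β : ℝ) (hα : 0 < α) (hβ : 0 < β)
    (hRpα : α ≤ πp * ∫ x, ℓ (g x) 1 ∂μp)
    (hRmβ : β ≤ πm * ∫ x, ℓ (g x) (-1) ∂μm) :
    0 ≤ (∫ ω : Fin n → X × X, (f (Rhatp g ω) + f (Rhatm g ω))
          ∂(Measure.pi fun _ : Fin n => μ.prod μ)) -
        (πp * (∫ x, ℓ (g x) 1 ∂μp) + πm * ∫ x, ℓ (g x) (-1) ∂μm) ∧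
    (∫ ω : Fin n → X × X, (f (Rhatp g ω) + f (Rhatm g ω))
          ∂(Measure.pi fun _ : Fin n => μ.prod μ)) -
        (πp * (∫ x, ℓ (g x) 1 ∂μp) + πm * ∫ x, ℓ (g x) (-1) ∂μm) ≤
      (2 * (Lf + 1) * Cl / |πp - πm|) *
        (Real.exp (-(α ^ 2) * (πp - πm) ^ 2 * n / (2 * Cl ^ 2)) +
         Real.exp (-(β ^ 2) * (πp - πm) ^ 2 * n / (2 * Cl ^ 2))) := by
  have hπm0 : 0 < πm := by linarith
  obtain ⟨hpint, hp_nonneg, hp_le⟩ := sconf_class_risk_bias ν hppm hpmm hpp0 hpm0 hμp hμm hπp0 hπm0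
    (by linarith) hne hpos hμ hs (hℓm1.comp hg) (fun x => hℓ01 (g x)) hCl0 (fun x => (hgb x).1)
    hn (hRhatp g) hk hf hα hRpα
  obtain ⟨hmint, hm_nonneg, hm_le⟩ := sconf_class_risk_bias ν hpmm hppm hpm0 hpp0 hμm hμp hπm0 hπp0
    (by linarith) hne.symm (hpos.mono fun x hx => by linarith) (hμ.trans (add_comm _ _))
    (s := s) (fun x x' => by rw [hs]; congr 1 <;> ring) (hℓm2.comp hg) (fun x => hℓ02 (g x)) hCl0
    (fun x => (hgb x).2) hn (Y := Rhatm g) (fun ω => by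
      rw [hRhatm, ← neg_sub πp πm, mul_neg, div_neg, neg_mul, ← mul_neg, ← Finset.sum_neg_distrib]
      simp only [← neg_mul, neg_sub, Function.comp_apply]) hk hf hβ hRmβ
  simp only [Function.comp_apply] at hp_nonneg hp_le hm_nonneg hm_le
  rw [integral_add hpint hmint]
  refine ⟨by linarith, ?_⟩
  rw [abs_sub_comm πm πp, ← neg_sub πp πm, neg_sq] at hm_le
  have hkL : k + 1 ≤ 2 * (Lf + 1) := by
    have h1 : 1 ≤ Lf := hLf ▸ le_max_left _ _
    have h2 : k ≤ Lf := hLf ▸ le_max_right _ _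
    linarith
  have hcoef : (k + 1) * (Cl / |πp - πm|) ≤ 2 * (Lf + 1) * Cl / |πp - πm| := by
    rw [mul_div_assoc]
    gcongr
  rw [mul_add]
  have h1 := hp_le.trans (mul_le_mul_of_nonneg_right hcoef (Real.exp_nonneg _))
  have h2 := hm_le.trans (mul_le_mul_of_nonneg_right hcoef (Real.exp_nonneg _))
  linarith
end

section
/- Unbiased risk expression from similar pairs (Theorem 1): Assume s(x,x') > 0 for ν⊗ν-a.e. (x,x'), and that x ↦ ℓ(g(x),+1) and x ↦ ℓ(g(x),−1) are integrable with respect to both μ₊ and μ₋. Then ∫ [π_S·(s(x,x') − π₋)·(ℓ(g(x),+1) + ℓ(g(x'),+1)) + π_S·(π₊ − s(x,x'))·(ℓ(g(x),−1) + ℓ(g(x'),−1))] / (2·(π₊−π₋)·s(x,x')) dμ_S(x,x') = R(g). -/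
open MeasureTheory ProbabilityTheory
open scoped ENNReal BigOperators

theorem integrable_withDensity_ofReal_iff {α : Type*} [MeasurableSpace α] {ν : Measure α}
    {f : α → ℝ} (hf : Measurable f) (hf0 : ∀ x, 0 ≤ f x) {h : α → ℝ} :
    Integrable h (ν.withDensity fun x => ENNReal.ofReal (f x)) ↔
      Integrable (fun x => f x * h x) ν := by
  rw [integrable_withDensity_iff_integrable_smul' hf.ennreal_ofReal
    (ae_of_all _ fun x => ENNReal.ofReal_lt_top)]
  simp only [ENNReal.toReal_ofReal (hf0 _), smul_eq_mul]

theorem integral_withDensity_ofReal {α : Type*} [MeasurableSpace α] {ν : Measure α}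
    {f : α → ℝ} (hf : Measurable f) (hf0 : ∀ x, 0 ≤ f x) (h : α → ℝ) :
    ∫ x, h x ∂(ν.withDensity fun x => ENNReal.ofReal (f x)) = ∫ x, f x * h x ∂ν := by
  rw [integral_withDensity_eq_integral_toReal_smul hf.ennreal_ofReal
    (ae_of_all _ fun x => ENNReal.ofReal_lt_top)]
  simp only [ENNReal.toReal_ofReal (hf0 _), smul_eq_mul]

/-- The integral of the symmetrization of `U ⊗ p + V ⊗ q` when `p` and `q` integrate to `1`. -/
theorem integral_symmetrized_prod {α : Type*} [MeasurableSpace α] {ν : Measure α} [SigmaFinite ν]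
    {p q U V : α → ℝ} (hp : Integrable p ν) (hq : Integrable q ν)
    (hU : Integrable U ν) (hV : Integrable V ν)
    (hp1 : ∫ x, p x ∂ν = 1) (hq1 : ∫ x, q x ∂ν = 1) :
    ∫ z : α × α, (U z.1 * p z.2 + V z.1 * q z.2 + (p z.1 * U z.2 + q z.1 * V z.2)) ∂(ν.prod ν)
      = 2 * ∫ x, (U x + V x) ∂ν := by
  have hUp := hU.mul_prod hp
  have hVq := hV.mul_prod hq
  have hpU := hp.mul_prod hU
  have hqV := hq.mul_prod hV
  have hadd := integral_add (hUp.add hVq) (hpU.add hqV)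
  simp only [Pi.add_apply] at hadd
  rw [hadd, integral_add hUp hVq, integral_add hpU hqV,
    integral_prod_mul, integral_prod_mul, integral_prod_mul, integral_prod_mul, hp1, hq1,
    integral_add hU hV]
  ring

theorem sconf_similar_pairs_unbiased
    {X : Type*} [MeasurableSpace X] (ν : Measure X) [SigmaFinite ν]
    (pp pm : X → ℝ) (hppm : Measurable pp) (hpmm : Measurable pm)
    (hpp0 : ∀ x, 0 ≤ pp x) (hpm0 : ∀ x, 0 ≤ pm x)
    (μp μm : Measure X) [IsProbabilityMeasure μp] [IsProbabilityMeasure μm]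
    (hμp : μp = ν.withDensity fun x => ENNReal.ofReal (pp x))
    (hμm : μm = ν.withDensity fun x => ENNReal.ofReal (pm x))
    (πp πm : ℝ) (hπp0 : 0 < πp) (hπp1 : πp < 1) (hπm : πm = 1 - πp)
    (hpos : ∀ᵐ x ∂ν, 0 < πp * pp x + πm * pm x)
    (μ : Measure X) [IsProbabilityMeasure μ]
    (hμ : μ = ENNReal.ofReal πp • μp + ENNReal.ofReal πm • μm)
    (s : X → X → ℝ)
    (hs : ∀ x x', s x x' = (πp ^ 2 * pp x * pp x' + πm ^ 2 * pm x * pm x') /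
        ((πp * pp x + πm * pm x) * (πp * pp x' + πm * pm x')))
    (hne : πp ≠ πm)
    (ℓ : ℝ → ℝ → ℝ)
    (hℓm1 : Measurable fun z => ℓ z 1) (hℓm2 : Measurable fun z => ℓ z (-1))
    (hℓ01 : ∀ z, 0 ≤ ℓ z 1) (hℓ02 : ∀ z, 0 ≤ ℓ z (-1))
    (g : X → ℝ) (hg : Measurable g)
    (hip1 : Integrable (fun x => ℓ (g x) 1) μp) (him1 : Integrable (fun x => ℓ (g x) 1) μm)
    (hip2 : Integrable (fun x => ℓ (g x) (-1)) μp) (him2 : Integrable (fun x => ℓ (g x) (-1)) μm)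
    (hspos : ∀ᵐ q ∂(ν.prod ν), 0 < s q.1 q.2)
    (πS : ℝ) (hπS : πS = πp ^ 2 + πm ^ 2)
    (μS : Measure (X × X))
    (hμS : μS = (ν.prod ν).withDensity fun q =>
      ENNReal.ofReal ((πp ^ 2 * pp q.1 * pp q.2 + πm ^ 2 * pm q.1 * pm q.2) / πS)) :
    (∫ q : X × X,
        (πS * (s q.1 q.2 - πm) * (ℓ (g q.1) 1 + ℓ (g q.2) 1) +
          πS * (πp - s q.1 q.2) * (ℓ (g q.1) (-1) + ℓ (g q.2) (-1))) /
          (2 * (πp - πm) * s q.1 q.2) ∂μS)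
      = πp * (∫ x, ℓ (g x) 1 ∂μp) + πm * ∫ x, ℓ (g x) (-1) ∂μm := by
  have hπm0 : 0 < πm := by linarith
  have hπS0 : 0 < πS := by rw [hπS]; positivity
  have hd : πp - πm ≠ 0 := sub_ne_zero.2 hne
  have hp : Integrable pp ν := by
    have h : Integrable (fun _ : X => (1 : ℝ)) μp := integrable_const 1
    rw [hμp, integrable_withDensity_ofReal_iff hppm hpp0] at h
    simpa using h
  have hm : Integrable pm ν := by
    have h : Integrable (fun _ : X => (1 : ℝ)) μm := integrable_const 1
    rw [hμm, integrable_withDensity_ofReal_iff hpmm hpm0] at h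
    simpa using h
  have hp1 : ∫ x, pp x ∂ν = 1 := by
    have h : ∫ _, (1 : ℝ) ∂μp = 1 := by simp
    rw [hμp, integral_withDensity_ofReal hppm hpp0] at h
    simpa using h
  have hm1 : ∫ x, pm x ∂ν = 1 := by
    have h : ∫ _, (1 : ℝ) ∂μm = 1 := by simp
    rw [hμm, integral_withDensity_ofReal hpmm hpm0] at h
    simpa using h
  rw [hμp, integrable_withDensity_ofReal_iff hppm hpp0] at hip1 hip2
  rw [hμm, integrable_withDensity_ofReal_iff hpmm hpm0] at him1 him2
  have hw : Measurable fun q : X × X =>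
      (πp ^ 2 * pp q.1 * pp q.2 + πm ^ 2 * pm q.1 * pm q.2) / πS := by fun_prop
  have hw0 : ∀ q : X × X,
      0 ≤ (πp ^ 2 * pp q.1 * pp q.2 + πm ^ 2 * pm q.1 * pm q.2) / πS := fun q => by
    have := hpp0 q.1
    have := hpp0 q.2
    have := hpm0 q.1
    have := hpm0 q.2
    positivity
  rw [hμS, integral_withDensity_ofReal hw hw0, hμp, hμm, integral_withDensity_ofReal hppm hpp0,
    integral_withDensity_ofReal hpmm hpm0]
  let U : X → ℝ := fun x => (πp ^ 2 - πm * πp ^ 2) * (pp x * ℓ (g x) 1)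
    - πm ^ 2 * πp * (pm x * ℓ (g x) 1) + (πp ^ 3 - πp ^ 2) * (pp x * ℓ (g x) (-1))
    + πp ^ 2 * πm * (pm x * ℓ (g x) (-1))
  let V : X → ℝ := fun x => (πm ^ 2 - πm ^ 3) * (pm x * ℓ (g x) 1)
    - πm ^ 2 * πp * (pp x * ℓ (g x) 1) + πp ^ 2 * πm * (pp x * ℓ (g x) (-1))
    + (πp * πm ^ 2 - πm ^ 2) * (pm x * ℓ (g x) (-1))
  have hU : Integrable U ν := (((hip1.const_mul _).sub (him1.const_mul _)).add
    (hip2.const_mul _)).add (him2.const_mul _)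
  have hV : Integrable V ν := (((him1.const_mul _).sub (hip1.const_mul _)).add
    (hip2.const_mul _)).add (him2.const_mul _)
  have hUV : ∀ x, U x + V x = (πp - πm) * (πp * (pp x * ℓ (g x) 1)
      + πm * (pm x * ℓ (g x) (-1))) := fun x => by
    simp only [U, V, hπm]
    ring
  have hint : ∀ᵐ q ∂(ν.prod ν),
      (πp ^ 2 * pp q.1 * pp q.2 + πm ^ 2 * pm q.1 * pm q.2) / πS *
        ((πS * (s q.1 q.2 - πm) * (ℓ (g q.1) 1 + ℓ (g q.2) 1) +
          πS * (πp - s q.1 q.2) * (ℓ (g q.1) (-1) + ℓ (g q.2) (-1))) /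
          (2 * (πp - πm) * s q.1 q.2))
      = (2 * (πp - πm))⁻¹ *
        (U q.1 * pp q.2 + V q.1 * pm q.2 + (pp q.1 * U q.2 + pm q.1 * V q.2)) := by
    filter_upwards [hspos] with q hq
    have hs' := hs q.1 q.2
    have hP : (πp * pp q.1 + πm * pm q.1) * (πp * pp q.2 + πm * pm q.2) ≠ 0 := by
      intro h
      rw [hs', h, div_zero] at hq
      exact lt_irrefl _ hq
    rw [eq_div_iff hP] at hs'
    have hs0 := hq.ne'
    rw [← hs']
    have hrhs : U q.1 * pp q.2 + V q.1 * pm q.2 + (pp q.1 * U q.2 + pm q.1 * V q.2)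
        = ((πp ^ 2 * pp q.1 * pp q.2 + πm ^ 2 * pm q.1 * pm q.2)
            - πm * ((πp * pp q.1 + πm * pm q.1) * (πp * pp q.2 + πm * pm q.2)))
            * (ℓ (g q.1) 1 + ℓ (g q.2) 1)
          + (πp * ((πp * pp q.1 + πm * pm q.1) * (πp * pp q.2 + πm * pm q.2))
            - (πp ^ 2 * pp q.1 * pp q.2 + πm ^ 2 * pm q.1 * pm q.2))
            * (ℓ (g q.1) (-1) + ℓ (g q.2) (-1)) := by
      simp only [U, V]
      ring
    rw [hrhs, ← hs']
    field_simp
  rw [integral_congr_ae hint, integral_const_mul, integral_symmetrized_prod hp hm hU hV hp1 hm1]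
  simp_rw [hUV]
  rw [integral_const_mul, integral_add (hip1.const_mul _) (him2.const_mul _), integral_const_mul,
    integral_const_mul]
  field_simp
end

section
/- Collapse of learning from only similar pairs (Theorem 2): Suppose π₊ > π₋ and sᵢ ≥ π₊ for all i = 1,…,n. Then for every function g: 𝒳 → ℝ, R̂_S(g) ≥ π_S·Σᵢ (π₊ − sᵢ)/(n·(π₊−π₋)·sᵢ), and equality holds for any g with g(x) > 0 for all x ∈ 𝒳. Consequently every classifier that labels all points positive is a minimizer of R̂_S over all functions g: 𝒳 → ℝ, i.e., the empirical risk minimizer of R̂_S is a collapsed solution. -/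
open MeasureTheory ProbabilityTheory
open scoped ENNReal BigOperators

theorem sconf_similar_only_collapse
    {X : Type*} [Nonempty X]
    (πp πm : ℝ) (hπp0 : 0 < πp) (hπp1 : πp < 1) (hπm : πm = 1 - πp)
    (hππ : πm < πp)
    (πS : ℝ) (hπS : πS = πp ^ 2 + πm ^ 2)
    (n : ℕ) (hn : 0 < n)
    (x x' : Fin n → X) (sc : Fin n → ℝ) (hsc : ∀ i, sc i ∈ Set.Ioc (0 : ℝ) 1)
    (hscπ : ∀ i, πp ≤ sc i)
    (ℓpos ℓneg : ℝ → ℝ)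
    (hℓpos : ∀ z, ℓpos z = if 0 < z then 0 else 1)
    (hℓneg : ∀ z, ℓneg z = if 0 < z then 1 else 0)
    (RhatS : (X → ℝ) → ℝ)
    (hRhatS : ∀ g, RhatS g = πS * ∑ i,
      ((sc i - πm) * (ℓpos (g (x i)) + ℓpos (g (x' i))) +
        (πp - sc i) * (ℓneg (g (x i)) + ℓneg (g (x' i)))) /
        (2 * (n : ℝ) * (πp - πm) * sc i)) :
    (∀ g : X → ℝ, πS * (∑ i, (πp - sc i) / ((n : ℝ) * (πp - πm) * sc i)) ≤ RhatS g) ∧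
    (∀ g : X → ℝ, (∀ z, 0 < g z) →
      RhatS g = πS * ∑ i, (πp - sc i) / ((n : ℝ) * (πp - πm) * sc i)) ∧
    (∀ g : X → ℝ, (∀ z, 0 < g z) → ∀ g' : X → ℝ, RhatS g ≤ RhatS g') := by
  have hS : 0 ≤ πS := by rw [hπS]; positivity
  have hn' : (0 : ℝ) < n := by exact_mod_cast hn
  have hd : 0 < πp - πm := sub_pos.mpr hππ
  have hrw : ∀ i, (πp - sc i) / ((n : ℝ) * (πp - πm) * sc i) =
      (2 * (πp - sc i)) / (2 * (n : ℝ) * (πp - πm) * sc i) := fun i => by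
    rw [mul_assoc 2, mul_assoc 2, mul_div_mul_left _ _ two_ne_zero]
  have lower : ∀ g : X → ℝ,
      πS * (∑ i, (πp - sc i) / ((n : ℝ) * (πp - πm) * sc i)) ≤ RhatS g := by
    intro g
    rw [hRhatS]
    refine mul_le_mul_of_nonneg_left (Finset.sum_le_sum fun i _ => ?_) hS
    have hs : 0 < sc i := (hsc i).1
    have hsp := hscπ i
    rw [hrw]
    refine div_le_div_of_nonneg_right ?_ (by positivity)
    simp only [hℓpos, hℓneg]
    split_ifs <;> linarith
  have attained : ∀ g : X → ℝ, (∀ z, 0 < g z) →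
      RhatS g = πS * ∑ i, (πp - sc i) / ((n : ℝ) * (πp - πm) * sc i) := by
    intro g hg
    rw [hRhatS]
    congr 1
    refine Finset.sum_congr rfl fun i _ => ?_
    rw [hrw]
    simp only [hℓpos, hℓneg, hg, if_true]
    ring
  exact ⟨lower, attained, fun g hg g' => (attained g hg).trans_le (lower g')⟩
end
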